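/- arXiv:1506.08744 — 3 statements merged into one kernel-verified Lean document; each statement's English description precedes it below -/
import Mathlib

section
/- The fundamental function L_k is a k-hyperbolic cardinal spline: L_k is 2k−2 times continuously differentiable on ℝ, and on ℝ ∖ ℤ it is 2k times differentiable and satisfies Σ_{m=0}^{k} binom(k,m) (−α²)^{k−m} L_k^{(2m)}(x) = 0, i.e. (D² − α²)^k L_k = 0 on ℝ ∖ ℤ. -/
open MeasureTheory Filter
open scoped ENNReal

noncomputable def S (α : ℝ) (k : ℕ) (ξ : ℝ) : ℝ :=
  ∑' j : ℤ, (((ξ - 2 * Real.pi * j) ^ 2 + α ^ 2) ^ k)⁻¹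

noncomputable def Lhat (α : ℝ) (k : ℕ) (ξ : ℝ) : ℝ :=
  (Real.sqrt (2 * Real.pi))⁻¹ * ((ξ ^ 2 + α ^ 2) ^ k)⁻¹ / S α k ξ

noncomputable def Lk (α : ℝ) (k : ℕ) (x : ℝ) : ℝ :=
  (((Real.sqrt (2 * Real.pi) : ℂ))⁻¹ *
    ∫ ξ : ℝ, (Lhat α k ξ : ℂ) * Complex.exp (Complex.I * x * ξ)).re

/-- A function `f : ℝ → ℝ` is a k-hyperbolic cardinal spline: it is `2k-2` times
continuously differentiable on ℝ and, on `ℝ \ ℤ`, it is `2k` times differentiable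
and satisfies `(D² - α²)^k f = 0`. -/
def IsHyperbolicSpline (α : ℝ) (k : ℕ) (f : ℝ → ℝ) : Prop :=
  ContDiff ℝ (2 * k - 2 : ℕ) f ∧
  ∀ x : ℝ, (∀ j : ℤ, x ≠ (j : ℝ)) →
    (∀ m < 2 * k, DifferentiableAt ℝ (iteratedDeriv m f) x) ∧
    ∑ m ∈ Finset.range (k + 1),
      (k.choose m : ℝ) * (-α ^ 2) ^ (k - m) * iteratedDeriv (2 * m) f x = 0

lemma hasDerivAt_cexp_const_mul_ofReal (c : ℂ) (x : ℝ) :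
    HasDerivAt (fun y : ℝ => Complex.exp (c * y)) (c * Complex.exp (c * x)) x := by
  have := ((hasDerivAt_id (x : ℂ)).const_mul c).cexp.comp_ofReal
  simpa [mul_comm] using this

/-- `f` solves `(D² - α²)^k f = 0` on `U`, expressed recursively through the first-order system
for `f` and its derivative, with `(D² - α²) f` a solution of order `k - 1`. -/
def IsHyperbolicSol (α : ℝ) (U : Set ℝ) : ℕ → (ℝ → ℂ) → Prop
  | 0, f => ∀ x ∈ U, f x = 0
  | k + 1, f => ∃ f' g : ℝ → ℂ, (∀ x ∈ U, HasDerivAt f (f' x) x) ∧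
      (∀ x ∈ U, HasDerivAt f' ((α : ℂ) ^ 2 * f x + g x) x) ∧ IsHyperbolicSol α U k g

namespace IsHyperbolicSol

variable {α : ℝ} {U : Set ℝ} {k : ℕ} {f : ℝ → ℂ}

lemma mono {V : Set ℝ} (hVU : V ⊆ U) : IsHyperbolicSol α U k f → IsHyperbolicSol α V k f := by
  induction k generalizing f with
  | zero => exact fun h x hx => h x (hVU hx)
  | succ k ih =>
    rintro ⟨f', g, h1, h2, h3⟩
    exact ⟨f', g, fun x hx => h1 x (hVU hx), fun x hx => h2 x (hVU hx), ih h3⟩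

lemma zero : IsHyperbolicSol α U k 0 := by
  induction k with
  | zero => exact fun x _ => rfl
  | succ k ih =>
    refine ⟨0, 0, fun x _ => ?_, fun x _ => ?_, ih⟩
    · simp
    · simp

lemma add {f₂ : ℝ → ℂ} (h : IsHyperbolicSol α U k f) (h₂ : IsHyperbolicSol α U k f₂) :
    IsHyperbolicSol α U k (f + f₂) := by
  induction k generalizing f f₂ with
  | zero => exact fun x hx => by simp [h x hx, h₂ x hx]
  | succ k ih =>
    obtain ⟨f', g, h1, h2, h3⟩ := h
    obtain ⟨f₂', g₂, i1, i2, i3⟩ := h₂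
    refine ⟨f' + f₂', g + g₂, fun x hx => (h1 x hx).add (i1 x hx), fun x hx => ?_, ih h3 i3⟩
    convert! (h2 x hx).add (i2 x hx) using 1
    simp only [Pi.add_apply]
    ring

lemma smul (c : ℂ) (h : IsHyperbolicSol α U k f) : IsHyperbolicSol α U k (c • f) := by
  induction k generalizing f with
  | zero => exact fun x hx => by simp [h x hx]
  | succ k ih =>
    obtain ⟨f', g, h1, h2, h3⟩ := h
    refine ⟨c • f', c • g, fun x hx => (h1 x hx).const_smul c, fun x hx => ?_, ih h3⟩
    convert! (h2 x hx).const_smul c using 1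
    simp only [Pi.smul_apply, smul_eq_mul]
    ring

lemma of_mem_span {s : Set (ℝ → ℂ)} (hs : ∀ w ∈ s, IsHyperbolicSol α U k w)
    (hf : f ∈ Submodule.span ℂ s) : IsHyperbolicSol α U k f := by
  induction hf using Submodule.span_induction with
  | mem w hw => exact hs w hw
  | zero => exact zero
  | add u v _ _ hu hv => exact hu.add hv
  | smul c u _ hu => exact hu.smul c

lemma comp_add_const (c : ℝ) (h : IsHyperbolicSol α U k f) :
    IsHyperbolicSol α ((· + c) ⁻¹' U) k (fun x => f (x + c)) := by
  induction k generalizing f with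
  | zero => exact fun x hx => h _ hx
  | succ k ih =>
    obtain ⟨f', g, h1, h2, h3⟩ := h
    exact ⟨fun x => f' (x + c), fun x => g (x + c), fun x hx => (h1 _ hx).comp_add_const x c,
      fun x hx => (h2 _ hx).comp_add_const x c, ih h3⟩

lemma contDiffOn (hU : IsOpen U) (h : IsHyperbolicSol α U k f) (n : ℕ) : ContDiffOn ℝ n f U := by
  have step : ∀ {u u' : ℝ → ℂ} {n : ℕ}, (∀ x ∈ U, HasDerivAt u (u' x) x) →
      ContDiffOn ℝ n u' U → ContDiffOn ℝ (n + 1 : ℕ) u U := by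
    intro u u' n hu hu'
    push_cast
    rw [contDiffOn_succ_iff_deriv_of_isOpen hU]
    exact ⟨fun x hx => (hu x hx).differentiableAt.differentiableWithinAt, by simp,
      hu'.congr fun x hx => (hu x hx).deriv⟩
  induction k generalizing f n with
  | zero => exact (contDiffOn_const (c := (0 : ℂ))).congr h
  | succ k ih =>
    obtain ⟨f', g, h1, h2, h3⟩ := h
    suffices H : ContDiffOn ℝ n f U ∧ ContDiffOn ℝ n f' U from H.1
    induction n with
    | zero =>
      simp only [CharP.cast_eq_zero, contDiffOn_zero]
      exact ⟨fun x hx => (h1 x hx).continuousAt.continuousWithinAt,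
        fun x hx => (h2 x hx).continuousAt.continuousWithinAt⟩
    | succ n ihn =>
      exact ⟨step h1 ihn.2, step h2 ((contDiffOn_const.mul ihn.1).add (ih h3 n))⟩

lemma sum_iteratedDeriv_eq_zero (hU : IsOpen U) (h : IsHyperbolicSol α U k f) {x : ℝ}
    (hx : x ∈ U) :
    ∑ m ∈ Finset.range (k + 1),
      (k.choose m : ℂ) * ((-α ^ 2 : ℂ) ^ (k - m) * iteratedDeriv (2 * m) f x) = 0 := by
  induction k generalizing f with
  | zero => simpa using h x hx
  | succ k ih =>
    have hf := h.contDiffOn hU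
    obtain ⟨f', g, h1, h2, h3⟩ := h
    have hev : g =ᶠ[nhds x] iteratedDeriv 2 f - (fun y => (α : ℂ) ^ 2 * f y) := by
      filter_upwards [hU.mem_nhds hx] with y hy
      have hd : deriv f =ᶠ[nhds y] f' := by
        filter_upwards [hU.mem_nhds hy] with z hz using (h1 z hz).deriv
      rw [Pi.sub_apply, iteratedDeriv_succ, iteratedDeriv_one, hd.deriv_eq, (h2 y hy).deriv]
      ring
    have hg : ∀ m, iteratedDeriv (2 * m) g x =
        iteratedDeriv (2 * (m + 1)) f x - (α : ℂ) ^ 2 * iteratedDeriv (2 * m) f x := by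
      intro m
      have hc' : ContDiffAt ℝ (2 * m : ℕ) f x := (hf _).contDiffAt (hU.mem_nhds hx)
      have h2' : ContDiffAt ℝ (2 * m : ℕ) (iteratedDeriv 2 f) x := by
        rw [iteratedDeriv_succ, iteratedDeriv_one]
        exact (((hf (2 * m + 2)).deriv_of_isOpen (m := (2 * m + 1 : ℕ)) hU
          (by norm_cast)).deriv_of_isOpen hU (by norm_cast)).contDiffAt (hU.mem_nhds hx)
      rw [hev.iteratedDeriv_eq, iteratedDeriv_sub h2' (contDiffAt_const.mul hc'),
        iteratedDeriv_const_mul _ hc', iteratedDeriv_eq_iterate, iteratedDeriv_eq_iterate,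
        iteratedDeriv_eq_iterate, iteratedDeriv_eq_iterate, ← Function.iterate_add_apply]
      rfl
    have key := ih h3
    rw [Finset.sum_choose_succ_mul (fun i j => (-α ^ 2 : ℂ) ^ j * iteratedDeriv (2 * i) f x),
      ← Finset.sum_add_distrib, ← key]
    refine Finset.sum_congr rfl fun m hm => ?_
    rw [hg, Nat.succ_sub (Nat.lt_succ_iff.mp (Finset.mem_range.mp hm)), pow_succ]
    ring

/-- Variation of constants for `D² u = α² u + w`. -/
lemma exists_particular (hα : α ≠ 0) {w : ℝ → ℂ} (hw : Continuous w) :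
    ∃ u u' : ℝ → ℂ, (∀ x, HasDerivAt u (u' x) x) ∧
      ∀ x, HasDerivAt u' ((α : ℂ) ^ 2 * u x + w x) x := by
  have hα' : (α : ℂ) ≠ 0 := by exact_mod_cast hα
  have he := hasDerivAt_cexp_const_mul_ofReal
  have hint : ∀ (c : ℂ) (x : ℝ), HasDerivAt (fun y : ℝ => ∫ t in (0 : ℝ)..y,
      Complex.exp (c * t) * w t) (Complex.exp (c * x) * w x) x := fun c x => by
    have hc : Continuous fun t : ℝ => Complex.exp (c * t) * w t := by fun_prop
    exact (hc.integral_hasStrictDerivAt 0 x).hasDerivAt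
  obtain ⟨A, hA⟩ : ∃ A : ℝ → ℂ, ∀ x : ℝ, HasDerivAt A (Complex.exp (-α * x) * w x) x :=
    ⟨_, hint (-α)⟩
  obtain ⟨B, hB⟩ : ∃ B : ℝ → ℂ, ∀ x : ℝ, HasDerivAt B (Complex.exp (α * x) * w x) x :=
    ⟨_, hint α⟩
  have hmul : ∀ x : ℝ, Complex.exp (α * x) * Complex.exp (-α * x) = 1 := fun x => by
    rw [← Complex.exp_add]; simp
  refine ⟨fun x => (Complex.exp (α * x) * A x - Complex.exp (-α * x) * B x) / (2 * α),
    fun x => (Complex.exp (α * x) * A x + Complex.exp (-α * x) * B x) / 2,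
    fun x => ?_, fun x => ?_⟩
  · refine ((((he α x).mul (hA x)).sub ((he (-α) x).mul (hB x))).div_const
      (2 * α : ℂ)).congr_deriv ?_
    dsimp only
    generalize Complex.exp (α * x) = E at *
    generalize Complex.exp (-α * x) = E' at *
    field_simp
    ring
  · refine ((((he α x).mul (hA x)).add ((he (-α) x).mul (hB x))).div_const
      (2 : ℂ)).congr_deriv ?_
    have := hmul x
    dsimp only
    generalize Complex.exp (α * x) = E at *
    generalize Complex.exp (-α * x) = E' at *
    field_simp
    linear_combination (2 * w x) * this

lemma exp_mul {c : ℂ} (hc : c ^ 2 = (α : ℂ) ^ 2) :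
    IsHyperbolicSol α U (k + 1) (fun x : ℝ => Complex.exp (c * x)) := by
  have he := hasDerivAt_cexp_const_mul_ofReal c
  refine ⟨fun x => c * Complex.exp (c * x), 0, fun x _ => he x, fun x _ => ?_, zero⟩
  convert! (he x).const_mul c using 1
  rw [← hc, Pi.zero_apply]
  ring

lemma eq_exp_of_homogeneous (hα : α ≠ 0) {a b : ℝ} {u u' : ℝ → ℂ}
    (h1 : ∀ x ∈ Set.Ioo a b, HasDerivAt u (u' x) x)
    (h2 : ∀ x ∈ Set.Ioo a b, HasDerivAt u' ((α : ℂ) ^ 2 * u x) x) :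
    ∃ c d : ℂ, ∀ x ∈ Set.Ioo a b,
      u x = c * Complex.exp (α * x) + d * Complex.exp (-α * x) := by
  have hα' : (α : ℂ) ≠ 0 := by exact_mod_cast hα
  have he := hasDerivAt_cexp_const_mul_ofReal
  have hconst : ∀ c : ℂ, c ^ 2 = (α : ℂ) ^ 2 → ∃ p : ℂ, ∀ x ∈ Set.Ioo a b,
      (u' x + c * u x) * Complex.exp (-c * x) = p := by
    intro c hc
    have hd : ∀ x ∈ Set.Ioo a b,
        HasDerivAt (fun x => (u' x + c * u x) * Complex.exp (-c * x)) 0 x := by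
      intro x hx
      convert! ((h2 x hx).add ((h1 x hx).const_mul c)).mul (he (-c) x) using 1
      rw [← hc]
      simp only [Pi.add_apply]
      ring
    refine isOpen_Ioo.exists_is_const_of_deriv_eq_zero isPreconnected_Ioo
      (fun x hx => (hd x hx).differentiableAt.differentiableWithinAt) fun x hx => (hd x hx).deriv
  obtain ⟨p, hp⟩ := hconst α rfl
  obtain ⟨q, hq⟩ := hconst (-α) (by ring)
  refine ⟨p / (2 * α), -q / (2 * α), fun x hx => ?_⟩
  have hmul : Complex.exp (α * x) * Complex.exp (-α * x) = 1 := by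
    rw [← Complex.exp_add]; simp
  rw [← hp x hx, ← hq x hx, neg_neg]
  generalize Complex.exp (α * x) = E at *
  generalize Complex.exp (-α * x) = E' at *
  field_simp
  linear_combination (-2 * α * u x) * hmul

lemma exists_finite_span (hα : α ≠ 0) (k : ℕ) (a b : ℝ) :
    ∃ s : Set (ℝ → ℂ), s.Finite ∧ (∀ w ∈ s, IsHyperbolicSol α Set.univ k w) ∧
      ∀ f, IsHyperbolicSol α (Set.Ioo a b) k f →
        ∃ w ∈ Submodule.span ℂ s, Set.EqOn f w (Set.Ioo a b) := by
  induction k with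
  | zero => exact ⟨∅, Set.finite_empty, by simp, fun f hf => ⟨0, by simp, hf⟩⟩
  | succ k ih =>
    obtain ⟨s, hs, hsol, hspan⟩ := ih
    have hpart : ∀ w : s, ∃ u u' : ℝ → ℂ, (∀ x, HasDerivAt u (u' x) x) ∧
        ∀ x, HasDerivAt u' ((α : ℂ) ^ 2 * u x + w.1 x) x := fun w =>
      exists_particular hα (contDiffOn_univ.mp ((hsol w w.2).contDiffOn isOpen_univ 0)).continuous
    choose K K' hK hK' using hpart
    have := hs.to_subtype
    set e₁ : ℝ → ℂ := fun x => Complex.exp (α * x)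
    set e₂ : ℝ → ℂ := fun x => Complex.exp (-α * x)
    refine ⟨Set.range K ∪ {e₁, e₂}, (Set.finite_range K).union (by simp), ?_, ?_⟩
    · rintro w (⟨v, rfl⟩ | rfl | rfl)
      · exact ⟨K' v, v, fun x _ => hK v x, fun x _ => hK' v x, hsol v v.2⟩
      · exact exp_mul rfl
      · exact exp_mul (by ring)
    · rintro f ⟨f', g, h1, h2, h3⟩
      obtain ⟨w, hw, hgw⟩ := hspan g h3
      have hpw : ∃ u ∈ Submodule.span ℂ (Set.range K ∪ {e₁, e₂}), ∃ u' : ℝ → ℂ,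
          (∀ x, HasDerivAt u (u' x) x) ∧ ∀ x, HasDerivAt u' ((α : ℂ) ^ 2 * u x + w x) x := by
        clear hgw
        induction hw using Submodule.span_induction with
        | mem w hw =>
          exact ⟨K ⟨w, hw⟩, Submodule.subset_span (Or.inl ⟨_, rfl⟩), K' ⟨w, hw⟩,
            hK ⟨w, hw⟩, hK' ⟨w, hw⟩⟩
        | zero =>
          refine ⟨0, zero_mem _, 0, fun x => ?_, fun x => ?_⟩
          · simp
          · simp
        | add w v _ _ hw hv =>
          obtain ⟨u, hu, u', i1, i2⟩ := hw
          obtain ⟨z, hz, z', j1, j2⟩ := hv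
          refine ⟨u + z, add_mem hu hz, u' + z', fun x => (i1 x).add (j1 x), fun x => ?_⟩
          convert! (i2 x).add (j2 x) using 1
          simp only [Pi.add_apply]
          ring
        | smul c w _ hw =>
          obtain ⟨u, hu, u', i1, i2⟩ := hw
          refine ⟨c • u, Submodule.smul_mem _ c hu, c • u', fun x => (i1 x).const_smul c,
            fun x => ?_⟩
          convert! (i2 x).const_smul c using 1
          simp only [Pi.smul_apply, smul_eq_mul]
          ring
      obtain ⟨u, hu, u', i1, i2⟩ := hpw
      obtain ⟨c, d, hcd⟩ := eq_exp_of_homogeneous (α := α) hα (a := a) (b := b)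
        (u := f - u) (u' := f' - u') (fun x hx => (h1 x hx).sub (i1 x)) (fun x hx => by
          convert! (h2 x hx).sub (i2 x) using 1
          rw [hgw hx, Pi.sub_apply]
          ring)
      refine ⟨u + (c • e₁ + d • e₂), add_mem hu (add_mem (Submodule.smul_mem _ _ ?_)
        (Submodule.smul_mem _ _ ?_)), fun x hx => ?_⟩
      · exact Submodule.subset_span (Or.inr (Or.inl rfl))
      · exact Submodule.subset_span (Or.inr (Or.inr rfl))
      · have := hcd x hx
        simp only [Pi.add_apply, Pi.smul_apply, Pi.sub_apply, smul_eq_mul, e₁, e₂] at this ⊢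
        rw [← this]
        ring

end IsHyperbolicSol

section FourierIntegral

open FourierTransform

lemma integral_mul_cexp_eq_fourier (f : ℝ → ℂ) (x : ℝ) :
    ∫ ξ : ℝ, f ξ * Complex.exp (Complex.I * x * ξ) = 𝓕 f ((-(2 * Real.pi)⁻¹) * x) := by
  rw [Real.fourier_real_eq_integral_exp_smul]
  refine integral_congr_ae (.of_forall fun ξ => ?_)
  have hpi : (Real.pi : ℂ) ≠ 0 := by exact_mod_cast Real.pi_ne_zero
  dsimp only
  rw [smul_eq_mul, mul_comm]
  congr 2
  push_cast
  field_simp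

lemma contDiff_integral_mul_cexp {f : ℝ → ℂ} {N : ℕ}
    (hf : ∀ n ≤ N, Integrable fun ξ : ℝ => |ξ| ^ n * ‖f ξ‖) :
    ContDiff ℝ N fun x : ℝ => ∫ ξ : ℝ, f ξ * Complex.exp (Complex.I * x * ξ) := by
  simp_rw [integral_mul_cexp_eq_fourier]
  have h : ContDiff ℝ (N : ℕ∞) (𝓕 f) :=
    Real.contDiff_fourier fun n hn => by simpa using hf n (by exact_mod_cast hn)
  exact ContDiff.comp (g := 𝓕 f) (by exact_mod_cast h) (contDiff_const.mul contDiff_id)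

lemma hasDerivAt_integral_mul_cexp {f : ℝ → ℂ} (hf : Integrable f)
    (hf' : Integrable fun ξ : ℝ => (ξ : ℂ) * f ξ) (x : ℝ) :
    HasDerivAt (fun x : ℝ => ∫ ξ : ℝ, f ξ * Complex.exp (Complex.I * x * ξ))
      (∫ ξ : ℝ, (Complex.I * ξ * f ξ) * Complex.exp (Complex.I * x * ξ)) x := by
  have h := Real.hasDerivAt_fourier hf (by simpa using hf') ((-(2 * Real.pi)⁻¹) * x)
  have hl : HasDerivAt (fun x : ℝ => (-(2 * Real.pi)⁻¹) * x) (-(2 * Real.pi)⁻¹) x := by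
    simpa using (hasDerivAt_id x).const_mul (-(2 * Real.pi)⁻¹)
  simp_rw [integral_mul_cexp_eq_fourier f]
  refine (h.scomp x hl).congr_deriv ?_
  rw [← integral_mul_cexp_eq_fourier, ← integral_smul]
  refine integral_congr_ae (.of_forall fun ξ => ?_)
  have hpi : (Real.pi : ℂ) ≠ 0 := by exact_mod_cast Real.pi_ne_zero
  simp only [smul_eq_mul, Complex.real_smul]
  push_cast
  field_simp

lemma fourier_exp_neg_mul_abs {α : ℝ} (hα : 0 < α) :
    Integrable (fun t : ℝ => (Real.exp (-α * |t|) : ℂ)) ∧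
      ∀ w : ℝ, 𝓕 (fun t : ℝ => (Real.exp (-α * |t|) : ℂ)) w =
        2 * α * (((2 * Real.pi * w) ^ 2 + α ^ 2 : ℝ) : ℂ)⁻¹ := by
  have hneg : ∀ c : ℂ, ∀ t ∈ Set.Iic (0 : ℝ),
      Complex.exp (c * t) * (Real.exp (-α * |t|) : ℂ) = Complex.exp ((c + α) * t) := by
    intro c t ht
    rw [abs_of_nonpos ht, Complex.ofReal_exp, ← Complex.exp_add]
    congr 1
    push_cast
    ring
  have hpos : ∀ c : ℂ, ∀ t ∈ Set.Ioi (0 : ℝ),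
      Complex.exp (c * t) * (Real.exp (-α * |t|) : ℂ) = Complex.exp ((c - α) * t) := by
    intro c t ht
    rw [abs_of_pos ht, Complex.ofReal_exp, ← Complex.exp_add]
    congr 1
    push_cast
    ring
  have ineg : ∀ c : ℂ, c.re = 0 → IntegrableOn
      (fun t : ℝ => Complex.exp (c * t) * (Real.exp (-α * |t|) : ℂ)) (Set.Iic 0) := fun c hc =>
    (integrableOn_exp_mul_complex_Iic (by simp [hc, hα]) 0).congr_fun
      (fun t ht => (hneg c t ht).symm) measurableSet_Iic
  have ipos : ∀ c : ℂ, c.re = 0 → IntegrableOn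
      (fun t : ℝ => Complex.exp (c * t) * (Real.exp (-α * |t|) : ℂ)) (Set.Ioi 0) := fun c hc =>
    (integrableOn_exp_mul_complex_Ioi (by simp [hc, hα]) 0).congr_fun
      (fun t ht => (hpos c t ht).symm) measurableSet_Ioi
  refine ⟨?_, fun w => ?_⟩
  · have h1 := ineg 0 rfl
    have h2 := ipos 0 rfl
    simp only [zero_mul, Complex.exp_zero, one_mul] at h1 h2
    rw [← integrableOn_univ, ← Set.Iic_union_Ioi (a := (0 : ℝ))]
    exact h1.union h2
  · set c : ℂ := -(2 * Real.pi * w) * Complex.I with hc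
    have hre : c.re = 0 := by simp [hc]
    have hint : 𝓕 (fun t : ℝ => (Real.exp (-α * |t|) : ℂ)) w =
        ∫ t : ℝ, Complex.exp (c * t) * (Real.exp (-α * |t|) : ℂ) := by
      rw [Real.fourier_real_eq_integral_exp_smul]
      refine integral_congr_ae (.of_forall fun t => ?_)
      dsimp only
      rw [smul_eq_mul, hc]
      congr 2
      push_cast
      ring
    rw [hint, ← intervalIntegral.integral_Iic_add_Ioi (ineg c hre) (ipos c hre),
      setIntegral_congr_fun measurableSet_Iic (hneg c),
      setIntegral_congr_fun measurableSet_Ioi (hpos c),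
      integral_exp_mul_complex_Iic (by simp [hre, hα]),
      integral_exp_mul_complex_Ioi (by simp [hre, hα])]
    have h1 : c + α ≠ 0 := fun h => hα.ne' (by simpa [hre] using congrArg Complex.re h)
    have h2 : c - α ≠ 0 := fun h => hα.ne' (by simpa [hre] using congrArg Complex.re h)
    have h3 : (((2 * Real.pi * w) ^ 2 + α ^ 2 : ℝ) : ℂ) = -((c + α) * (c - α)) := by
      rw [hc]
      push_cast
      linear_combination (2 * Real.pi * w : ℂ) ^ 2 * Complex.I_sq
    rw [h3]
    simp only [Complex.ofReal_zero, mul_zero, Complex.exp_zero]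
    field_simp
    ring

end FourierIntegral

lemma integrable_pow_mul_inv_sq_add_sq_pow {α : ℝ} (hα : 0 < α) {k n : ℕ} (hn : n + 2 ≤ 2 * k) :
    Integrable fun ξ : ℝ => |ξ| ^ n * ((ξ ^ 2 + α ^ 2) ^ k)⁻¹ := by
  have hk : k - 1 + 1 = k := by omega
  set c : ℝ := min 1 (α ^ 2) with hc
  have hc0 : 0 < c := lt_min one_pos (by positivity)
  refine (integrable_inv_one_add_sq.const_mul (c ^ k)⁻¹).mono' ?_ (.of_forall fun ξ => ?_)
  · refine Continuous.aestronglyMeasurable (Continuous.mul (by fun_prop)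
      (Continuous.inv₀ (by fun_prop) fun ξ => by positivity))
  · have h1 : c * (1 + ξ ^ 2) ≤ ξ ^ 2 + α ^ 2 := by
      nlinarith [min_le_left 1 (α ^ 2), min_le_right 1 (α ^ 2), sq_nonneg ξ]
    have h2 : |ξ| ^ n ≤ (1 + ξ ^ 2) ^ (k - 1) := by
      rcases le_total |ξ| 1 with h | h
      · exact (pow_le_one₀ (abs_nonneg ξ) h).trans (one_le_pow₀ (by nlinarith [sq_nonneg ξ]))
      · calc |ξ| ^ n ≤ |ξ| ^ (2 * (k - 1)) := pow_le_pow_right₀ h (by omega)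
          _ = (ξ ^ 2) ^ (k - 1) := by rw [pow_mul, sq_abs]
          _ ≤ _ := pow_le_pow_left₀ (sq_nonneg ξ) (by linarith) _
    rw [Real.norm_of_nonneg (by positivity)]
    calc |ξ| ^ n * ((ξ ^ 2 + α ^ 2) ^ k)⁻¹
        ≤ (1 + ξ ^ 2) ^ (k - 1) * ((c * (1 + ξ ^ 2)) ^ k)⁻¹ := by gcongr
      _ = (c ^ k)⁻¹ * (1 + ξ ^ 2)⁻¹ := by
        rw [mul_pow, ← hk, pow_succ (1 + ξ ^ 2), Nat.add_sub_cancel]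
        have : 1 + ξ ^ 2 ≠ 0 := by positivity
        field_simp

lemma integrable_pow_mul_inv_sq_add_sq_pow_ofReal {α : ℝ} (hα : 0 < α) {k n : ℕ}
    (hn : n + 2 ≤ 2 * k) :
    Integrable fun ξ : ℝ => (ξ : ℂ) ^ n * ((((ξ ^ 2 + α ^ 2) ^ k)⁻¹ : ℝ) : ℂ) := by
  refine (integrable_pow_mul_inv_sq_add_sq_pow hα hn).mono' ?_ (.of_forall fun ξ => ?_)
  · refine Continuous.aestronglyMeasurable (Continuous.mul (by fun_prop)
      (Complex.continuous_ofReal.comp (Continuous.inv₀ (by fun_prop) fun ξ => by positivity)))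
  · rw [norm_mul, norm_pow, Complex.norm_real, Complex.norm_real, Real.norm_eq_abs,
      Real.norm_of_nonneg (by positivity : (0 : ℝ) ≤ ((ξ ^ 2 + α ^ 2) ^ k)⁻¹)]

lemma integral_inv_sq_add_sq_mul_cexp {α : ℝ} (hα : 0 < α) (x : ℝ) :
    ∫ ξ : ℝ, (((ξ ^ 2 + α ^ 2)⁻¹ : ℝ) : ℂ) * Complex.exp (Complex.I * x * ξ) =
      (Real.pi / α : ℂ) * Complex.exp (-α * |x|) := by
  obtain ⟨hint, hF⟩ := fourier_exp_neg_mul_abs hα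
  have hpi : (Real.pi : ℂ) ≠ 0 := by exact_mod_cast Real.pi_ne_zero
  have hα' : (α : ℂ) ≠ 0 := by exact_mod_cast hα.ne'
  have hbase : Integrable fun ξ : ℝ => (((ξ ^ 2 + α ^ 2)⁻¹ : ℝ) : ℂ) := by
    simpa using integrable_pow_mul_inv_sq_add_sq_pow_ofReal hα (k := 1) (n := 0) (by norm_num)
  have hFint : Integrable (FourierTransform.fourier
      fun t : ℝ => (Real.exp (-α * |t|) : ℂ)) := by
    simp_rw [funext hF]
    refine Integrable.const_mul ?_ _
    simpa using hbase.comp_mul_left' (R := 2 * Real.pi) (by positivity)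
  have hinv := congrFun (Continuous.fourierInv_fourier_eq
    (f := fun t : ℝ => (Real.exp (-α * |t|) : ℂ)) (by fun_prop) hint hFint) x
  rw [Real.fourierInv_eq'] at hinv
  simp_rw [hF] at hinv
  have hsub := Measure.integral_comp_mul_left (fun ξ : ℝ =>
    (((ξ ^ 2 + α ^ 2)⁻¹ : ℝ) : ℂ) * Complex.exp (Complex.I * x * ξ)) (2 * Real.pi)
  have hval : (∫ w : ℝ, (((2 * Real.pi * w) ^ 2 + α ^ 2 : ℝ)⁻¹ : ℝ) *
      Complex.exp (Complex.I * x * (2 * Real.pi * w : ℝ))) =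
      (2 * α : ℂ)⁻¹ * Complex.exp (-α * |x|) := by
    rw [eq_inv_mul_iff_mul_eq₀ (by simpa using hα'), ← integral_const_mul]
    push_cast at hinv
    rw [← hinv]
    refine integral_congr_ae (.of_forall fun w => ?_)
    simp only [smul_eq_mul, RCLike.inner_apply, conj_trivial]
    push_cast
    ring_nf
  rw [hval, abs_of_pos (by positivity : 0 < (2 * Real.pi)⁻¹), Complex.real_smul] at hsub
  push_cast at hsub
  rw [eq_comm, inv_mul_eq_iff_eq_mul₀ (by simp)] at hsub
  push_cast at hsub ⊢
  rw [hsub]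
  field_simp

lemma isHyperbolicSol_integral {α : ℝ} (hα : 0 < α) {k : ℕ} (hk : 1 ≤ k) :
    IsHyperbolicSol α {0}ᶜ k fun x : ℝ =>
      ∫ ξ : ℝ, ((((ξ ^ 2 + α ^ 2) ^ k)⁻¹ : ℝ) : ℂ) * Complex.exp (Complex.I * x * ξ) := by
  have hα' : (α : ℂ) ≠ 0 := by exact_mod_cast hα.ne'
  induction k, hk using Nat.le_induction with
  | base =>
    simp only [pow_one, integral_inv_sq_add_sq_mul_cexp hα]
    have hloc : ∀ x : ℝ, x ≠ 0 → ∃ s : ℝ, s ^ 2 = 1 ∧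
        ∀ᶠ y in nhds x, |y| = s * y ∧ Real.sign y = s := by
      intro x hx
      rcases lt_or_gt_of_ne hx with h | h
      · refine ⟨-1, by norm_num, ?_⟩
        filter_upwards [gt_mem_nhds h] with y hy
        simp [abs_of_neg hy, Real.sign_of_neg hy]
      · refine ⟨1, by norm_num, ?_⟩
        filter_upwards [lt_mem_nhds h] with y hy
        simp [abs_of_pos hy, Real.sign_of_pos hy]
    refine ⟨fun x => -α * Real.sign x * ((Real.pi / α : ℂ) * Complex.exp (-α * |x|)), 0,
      fun x hx => ?_, fun x hx => ?_, IsHyperbolicSol.zero⟩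
    · obtain ⟨s, hs, hev⟩ := hloc x hx
      have hd := (hasDerivAt_cexp_const_mul_ofReal (-α * s) x).const_mul (Real.pi / α : ℂ)
      dsimp only
      rw [hev.self_of_nhds.1, hev.self_of_nhds.2]
      refine (hd.congr_of_eventuallyEq ?_).congr_deriv ?_
      · filter_upwards [hev] with y hy
        rw [hy.1]
        push_cast
        ring_nf
      · push_cast
        ring_nf
    · obtain ⟨s, hs, hev⟩ := hloc x hx
      have hs' : (s : ℂ) ^ 2 = 1 := by exact_mod_cast hs
      have hd := ((hasDerivAt_cexp_const_mul_ofReal (-α * s) x).const_mul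
        (Real.pi / α : ℂ)).const_mul (-α * s : ℂ)
      dsimp only
      rw [hev.self_of_nhds.1]
      refine (hd.congr_of_eventuallyEq ?_).congr_deriv ?_
      · filter_upwards [hev] with y hy
        rw [hy.1, hy.2]
        push_cast
        ring_nf
      · push_cast
        rw [Pi.zero_apply, ← mul_assoc (-(α : ℂ)) (s : ℂ) (x : ℂ)]
        linear_combination (α ^ 2 * (Real.pi / α) * Complex.exp (-α * s * x) : ℂ) * hs'
  | succ k hk ih =>
    set q : ℝ → ℂ := fun ξ => ((((ξ ^ 2 + α ^ 2) ^ (k + 1))⁻¹ : ℝ) : ℂ) with hq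
    have hint : ∀ n ≤ 2, Integrable fun ξ : ℝ => (ξ : ℂ) ^ n * q ξ := fun n hn =>
      integrable_pow_mul_inv_sq_add_sq_pow_ofReal hα (by omega)
    have i0 : Integrable q := by simpa using hint 0 (by norm_num)
    have i1 : Integrable fun ξ : ℝ => (ξ : ℂ) * q ξ := by simpa using hint 1 (by norm_num)
    have i1' : Integrable fun ξ : ℝ => Complex.I * ξ * q ξ := by
      simpa [mul_assoc] using i1.const_mul Complex.I
    have i2 : Integrable fun ξ : ℝ => (ξ : ℂ) * (Complex.I * ξ * q ξ) := by
      refine ((hint 2 le_rfl).const_mul Complex.I).congr (.of_forall fun ξ => ?_)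
      ring
    have hexp : ∀ {p : ℝ → ℂ} (x : ℝ), Integrable p →
        Integrable fun ξ : ℝ => p ξ * Complex.exp (Complex.I * x * ξ) := by
      intro p x hp
      refine hp.mul_bdd (c := 1) (Continuous.aestronglyMeasurable (by fun_prop))
        (.of_forall fun ξ => ?_)
      simp [Complex.norm_exp]
    refine ⟨_, _, fun x _ => hasDerivAt_integral_mul_cexp i0 i1 x,
      fun x _ => (hasDerivAt_integral_mul_cexp i1' i2 x).congr_deriv ?_, ih.smul (-1)⟩
    have ik : Integrable fun ξ : ℝ => ((((ξ ^ 2 + α ^ 2) ^ k)⁻¹ : ℝ) : ℂ) := by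
      simpa using integrable_pow_mul_inv_sq_add_sq_pow_ofReal hα (k := k) (n := 0) (by omega)
    rw [Pi.smul_apply, neg_one_smul, ← sub_eq_add_neg, ← integral_const_mul,
      ← integral_sub ((hexp x i0).const_mul _) (hexp x ik)]
    refine integral_congr_ae (.of_forall fun ξ => ?_)
    have hne : ((ξ : ℂ) ^ 2 + (α : ℂ) ^ 2) ≠ 0 := by
      have : ξ ^ 2 + α ^ 2 ≠ 0 := by positivity
      exact_mod_cast this
    simp only [hq]
    push_cast
    rw [pow_succ]
    field_simp
    linear_combination (ξ ^ 2 : ℂ) * Complex.I_sq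

section Periodization

variable {α : ℝ} {k : ℕ}

/-- On bounded sets of `ξ`, the terms of `S` are dominated by a common summable family. -/
lemma exists_summable_bound (hα : 0 < α) (hk : 1 ≤ k) (R : ℝ) :
    ∃ u : ℤ → ℝ, Summable u ∧ ∀ j : ℤ, ∀ ξ : ℝ, |ξ| ≤ R →
      (((ξ - 2 * Real.pi * j) ^ 2 + α ^ 2) ^ k)⁻¹ ≤ u j := by
  set t : ℝ := α ^ 2 / (2 * (R ^ 2 + α ^ 2)) with ht
  have hα2 : 0 < α ^ 2 := by positivity
  have ht0 : 0 < t := by positivity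
  have ht1 : t ≤ 1 := by
    rw [ht, div_le_one (by positivity)]
    nlinarith [sq_nonneg R]
  have htR : t * R ^ 2 ≤ α ^ 2 / 2 := by
    rw [ht, div_mul_eq_mul_div, div_le_div_iff₀ (by positivity) (by positivity)]
    nlinarith [mul_pos hα2 hα2]
  set c : ℝ := min t (α ^ 2 / 2) with hc
  have hc0 : 0 < c := lt_min ht0 (by positivity)
  refine ⟨fun j => (c ^ k)⁻¹ * (1 + (j : ℝ) ^ 2)⁻¹, Summable.mul_left _ ?_, fun j ξ hξ => ?_⟩
  · have h := Real.summable_one_div_int_pow.mpr (one_lt_two : 1 < 2)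
    refine h.of_norm_bounded_eventually ?_
    filter_upwards [(Set.finite_singleton (0 : ℤ)).compl_mem_cofinite] with j hj
    have hj' : (j : ℝ) ≠ 0 := by exact_mod_cast hj
    rw [Real.norm_of_nonneg (by positivity), one_div]
    exact inv_anti₀ (by positivity) (by linarith)
  · have hlow : c * (1 + (j : ℝ) ^ 2) ≤ (ξ - 2 * Real.pi * j) ^ 2 + α ^ 2 := by
      have hξ2 : ξ ^ 2 ≤ R ^ 2 :=
        sq_le_sq' (by linarith [neg_abs_le ξ]) (by linarith [le_abs_self ξ])
      have hpi : 1 ≤ 2 * Real.pi ^ 2 := by nlinarith [Real.pi_gt_three]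
      have h1 : (j : ℝ) ^ 2 - R ^ 2 ≤ (ξ - 2 * Real.pi * j) ^ 2 := by
        nlinarith [sq_nonneg (2 * ξ - 2 * Real.pi * j), mul_le_mul_of_nonneg_right hpi
          (sq_nonneg (j : ℝ))]
      have h2 : t * ((j : ℝ) ^ 2 - R ^ 2) ≤ (ξ - 2 * Real.pi * j) ^ 2 := by
        nlinarith [mul_le_mul_of_nonneg_left h1 ht0.le, mul_le_mul_of_nonneg_right ht1
          (sq_nonneg (ξ - 2 * Real.pi * j))]
      have h3 : c * (j : ℝ) ^ 2 ≤ t * (j : ℝ) ^ 2 :=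
        mul_le_mul_of_nonneg_right (min_le_left _ _) (sq_nonneg _)
      linarith [min_le_right t (α ^ 2 / 2)]
    have hpow : 1 + (j : ℝ) ^ 2 ≤ (1 + (j : ℝ) ^ 2) ^ k :=
      le_self_pow₀ (by nlinarith [sq_nonneg (j : ℝ)]) (by omega)
    dsimp only
    rw [← mul_inv]
    refine inv_anti₀ (by positivity) ?_
    calc c ^ k * (1 + (j : ℝ) ^ 2) ≤ c ^ k * (1 + (j : ℝ) ^ 2) ^ k := by gcongr
      _ = (c * (1 + (j : ℝ) ^ 2)) ^ k := (mul_pow _ _ _).symm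
      _ ≤ _ := by gcongr

lemma summable_S (hα : 0 < α) (hk : 1 ≤ k) (ξ : ℝ) :
    Summable fun j : ℤ => (((ξ - 2 * Real.pi * j) ^ 2 + α ^ 2) ^ k)⁻¹ := by
  obtain ⟨u, hu, hb⟩ := exists_summable_bound hα hk |ξ|
  exact hu.of_nonneg_of_le (fun j => by positivity) fun j => hb j ξ le_rfl

lemma S_pos (hα : 0 < α) (hk : 1 ≤ k) (ξ : ℝ) : 0 < S α k ξ :=
  (summable_S hα hk ξ).tsum_pos (fun j => by positivity) 0 (by positivity)

lemma continuous_S (hα : 0 < α) (hk : 1 ≤ k) : Continuous (S α k) := by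
  rw [continuous_iff_continuousAt]
  intro x
  obtain ⟨u, hu, hb⟩ := exists_summable_bound hα hk (|x| + 1)
  have hon : ContinuousOn (S α k) {ξ | |ξ| < |x| + 1} := by
    refine continuousOn_tsum (fun j => Continuous.continuousOn ?_) hu fun j ξ hξ => ?_
    · exact Continuous.inv₀ (by fun_prop) fun ξ => by positivity
    · rw [Real.norm_of_nonneg (by positivity)]
      exact hb j ξ (le_of_lt hξ)
  exact hon.continuousAt ((isOpen_lt continuous_abs continuous_const).mem_nhds (by simp))

lemma periodic_S (α : ℝ) (k : ℕ) : Function.Periodic (S α k) (2 * Real.pi) := by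
  intro ξ
  rw [S, S, ← (Equiv.addRight (1 : ℤ)).tsum_eq]
  refine tsum_congr fun j => ?_
  rw [Equiv.coe_addRight]
  push_cast
  ring_nf

/-- The periodic factor of the integrand defining `Lk`, as a function on the circle. -/
lemma exists_circle_lift (hα : 0 < α) (hk : 1 ≤ k) (c : ℂ) :
    ∃ G : C(AddCircle (2 * Real.pi), ℂ), ∀ ξ : ℝ, G ξ = c * (S α k ξ : ℂ)⁻¹ := by
  have hper : Function.Periodic (fun ξ => c * (S α k ξ : ℂ)⁻¹) (2 * Real.pi) := fun ξ => by
    simp only [periodic_S α k ξ]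
  refine ⟨⟨hper.lift, ?_⟩, fun ξ => hper.lift_coe ξ⟩
  refine continuous_coinduced_dom.mpr ?_
  exact continuous_const.mul ((Complex.continuous_ofReal.comp (continuous_S hα hk)).inv₀
    fun ξ => by simpa using (S_pos hα hk ξ).ne')

lemma integrable_mul_circle (hα : 0 < α) (hk : 1 ≤ k) (G : C(AddCircle (2 * Real.pi), ℂ))
    (x : ℝ) : Integrable fun ξ : ℝ => ((((ξ ^ 2 + α ^ 2) ^ k)⁻¹ : ℝ) : ℂ) * G ξ *
      Complex.exp (Complex.I * x * ξ) := by
  have : Fact (0 < 2 * Real.pi) := ⟨by positivity⟩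
  have hG : Continuous fun ξ : ℝ => G ξ := G.continuous.comp (AddCircle.continuous_mk' _)
  have hq : Integrable fun ξ : ℝ => ((((ξ ^ 2 + α ^ 2) ^ k)⁻¹ : ℝ) : ℂ) := by
    simpa using integrable_pow_mul_inv_sq_add_sq_pow_ofReal hα (k := k) (n := 0) (by omega)
  refine (hq.mul_bdd (c := ‖G‖) hG.aestronglyMeasurable
    (.of_forall fun ξ => G.norm_coe_le_norm _)).mul_bdd (c := 1)
    (Continuous.aestronglyMeasurable (by fun_prop)) (.of_forall fun ξ => ?_)
  simp [Complex.norm_exp]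

lemma exists_isHyperbolicSol_eqOn (hα : 0 < α) (hk : 1 ≤ k) (G : C(AddCircle (2 * Real.pi), ℂ))
    (n : ℤ) : ∃ w : ℝ → ℂ, IsHyperbolicSol α Set.univ k w ∧
      Set.EqOn (fun x : ℝ => ∫ ξ : ℝ, ((((ξ ^ 2 + α ^ 2) ^ k)⁻¹ : ℝ) : ℂ) * G ξ *
        Complex.exp (Complex.I * x * ξ)) w (Set.Ioo n (n + 1)) := by
  have : Fact (0 < 2 * Real.pi) := ⟨by positivity⟩
  obtain ⟨s, hs, hsol, hspan⟩ :=
    IsHyperbolicSol.exists_finite_span hα.ne' k (n : ℝ) ((n : ℝ) + 1)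
  let T : C(AddCircle (2 * Real.pi), ℂ) →ₗ[ℂ] (Set.Ioo (n : ℝ) (n + 1) → ℂ) :=
    { toFun := fun G x => ∫ ξ : ℝ, ((((ξ ^ 2 + α ^ 2) ^ k)⁻¹ : ℝ) : ℂ) * G ξ *
        Complex.exp (Complex.I * (x : ℝ) * ξ)
      map_add' := fun G H => by
        ext x
        rw [Pi.add_apply, ← integral_add (integrable_mul_circle hα hk G x)
          (integrable_mul_circle hα hk H x)]
        simp only [ContinuousMap.add_apply, mul_add, add_mul]
      map_smul' := fun c G => by
        ext x
        rw [Pi.smul_apply, RingHom.id_apply, ← integral_smul]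
        refine integral_congr_ae (.of_forall fun ξ => ?_)
        simp only [ContinuousMap.smul_apply, smul_eq_mul]
        ring }
  have hT : Continuous T := by
    refine continuous_pi fun x => ?_
    refine AddMonoidHomClass.continuous_of_bound ((LinearMap.proj x).comp T)
      (∫ ξ : ℝ, ((ξ ^ 2 + α ^ 2) ^ k)⁻¹) fun G => ?_
    have hq : Integrable fun ξ : ℝ => ((ξ ^ 2 + α ^ 2) ^ k)⁻¹ := by
      simpa using integrable_pow_mul_inv_sq_add_sq_pow hα (k := k) (n := 0) (by omega)
    rw [← integral_mul_const]
    refine norm_integral_le_of_norm_le (hq.mul_const _) (.of_forall fun ξ => ?_)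
    rw [norm_mul, norm_mul, Complex.norm_real, Real.norm_of_nonneg (by positivity)]
    have h1 : ‖Complex.exp (Complex.I * ((x : ℝ) : ℂ) * ξ)‖ = 1 := by simp [Complex.norm_exp]
    rw [h1, mul_one]
    gcongr
    exact G.norm_coe_le_norm _
  set W := (Submodule.span ℂ s).map
    (LinearMap.funLeft ℂ ℂ (Subtype.val : Set.Ioo (n : ℝ) (n + 1) → ℝ))
  have : FiniteDimensional ℂ (Submodule.span ℂ s) := FiniteDimensional.span_of_finite ℂ hs
  have hclosed : IsClosed ((W.comap T : Submodule ℂ _) : Set C(AddCircle (2 * Real.pi), ℂ)) :=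
    W.closed_of_finiteDimensional.preimage hT
  have hfourier : Submodule.span ℂ (Set.range (fourier (T := 2 * Real.pi))) ≤ W.comap T := by
    rw [Submodule.span_le]
    rintro _ ⟨j, rfl⟩
    have hj := (isHyperbolicSol_integral hα hk).comp_add_const (j : ℝ)
    have hsub : Set.Ioo (n : ℝ) (n + 1) ⊆ (· + (j : ℝ)) ⁻¹' {0}ᶜ := fun x hx h0 => by
      have h0' : x = ((-j : ℤ) : ℝ) := by
        push_cast
        linarith [show x + j = 0 from h0]
      rw [h0'] at hx
      have h1 : n < -j := by exact_mod_cast hx.1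
      have h2 : -j < n + 1 := by exact_mod_cast hx.2
      omega
    obtain ⟨w, hw, heq⟩ := hspan _ (hj.mono hsub)
    refine ⟨w, hw, ?_⟩
    ext x
    rw [LinearMap.funLeft_apply, ← heq x.2]
    refine integral_congr_ae (.of_forall fun ξ => ?_)
    have hpi : (Real.pi : ℂ) ≠ 0 := by exact_mod_cast Real.pi_ne_zero
    dsimp only
    rw [fourier_coe_apply, mul_assoc _ (Complex.exp _), ← Complex.exp_add]
    congr 2
    push_cast
    field_simp
    ring
  have htop : (⊤ : Submodule ℂ C(AddCircle (2 * Real.pi), ℂ)) ≤ W.comap T := by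
    rw [← span_fourier_closure_eq_top]
    exact Submodule.topologicalClosure_minimal _ hfourier hclosed
  obtain ⟨w, hw, heq⟩ := htop (Submodule.mem_top (x := G))
  exact ⟨w, IsHyperbolicSol.of_mem_span hsol hw, fun x hx => (congrFun heq ⟨x, hx⟩).symm⟩

end Periodization

lemma iteratedDeriv_re {v : ℝ → ℂ} {n : ℕ} {x : ℝ} (hv : ContDiffAt ℝ n v x) :
    iteratedDeriv n (fun y => (v y).re) x = (iteratedDeriv n v x).re := by
  have h := Complex.reCLM.iteratedFDeriv_comp_left hv le_rfl
  exact congrArg (fun M => M fun _ => 1) h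

/-- The fundamental function Lₖ is a k-hyperbolic cardinal spline. -/
theorem stmt_3 (α : ℝ) (hα : 0 < α) (k : ℕ) (hk : 1 ≤ k) :
    IsHyperbolicSpline α k (Lk α k) := by
  have : Fact (0 < 2 * Real.pi) := ⟨by positivity⟩
  obtain ⟨G, hG⟩ := exists_circle_lift hα hk ((Real.sqrt (2 * Real.pi) : ℂ)⁻¹ ^ 2)
  have hLk : Lk α k = fun x : ℝ => (∫ ξ : ℝ, ((((ξ ^ 2 + α ^ 2) ^ k)⁻¹ : ℝ) : ℂ) * G ξ *
      Complex.exp (Complex.I * x * ξ)).re := by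
    ext x
    rw [Lk, ← integral_const_mul]
    congr 2
    ext ξ
    rw [hG, Lhat]
    push_cast
    ring
  refine ⟨?_, fun x hx => ?_⟩
  · rw [hLk]
    refine Complex.reCLM.contDiff.comp (contDiff_integral_mul_cexp (f := fun ξ : ℝ =>
      ((((ξ ^ 2 + α ^ 2) ^ k)⁻¹ : ℝ) : ℂ) * G ξ) fun n hn => ?_)
    have hGc : Continuous fun ξ : ℝ => ‖G ξ‖ :=
      (G.continuous.comp (AddCircle.continuous_mk' _)).norm
    refine ((integrable_pow_mul_inv_sq_add_sq_pow hα (k := k) (n := n) (by omega)).mul_bdd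
      (c := ‖G‖) hGc.aestronglyMeasurable
      (.of_forall fun ξ => by simpa using G.norm_coe_le_norm _)).congr (.of_forall fun ξ => ?_)
    dsimp only
    rw [norm_mul, Complex.norm_real, Real.norm_of_nonneg (by positivity), mul_assoc]
  · obtain ⟨w, hw, heq⟩ := exists_isHyperbolicSol_eqOn hα hk G ⌊x⌋
    have hmem : x ∈ Set.Ioo (⌊x⌋ : ℝ) (⌊x⌋ + 1) :=
      ⟨lt_of_le_of_ne (Int.floor_le x) (hx _).symm, Int.lt_floor_add_one x⟩
    have hev : Lk α k =ᶠ[nhds x] fun y => (w y).re := by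
      filter_upwards [isOpen_Ioo.mem_nhds hmem] with y hy
      rw [hLk, ← heq hy]
    have hwc : ∀ n : ℕ, ContDiff ℝ n w := fun n =>
      contDiffOn_univ.mp (hw.contDiffOn isOpen_univ n)
    refine ⟨fun m _ => ?_, ?_⟩
    · refine DifferentiableAt.congr_of_eventuallyEq ?_ (hev.iteratedDeriv m)
      have hre : ContDiff ℝ (m + 1 : ℕ) fun y => (w y).re :=
        Complex.reCLM.contDiff.comp (hwc (m + 1))
      exact hre.differentiable_iteratedDeriv m (by exact_mod_cast m.lt_succ_self) x
    · have hsum := congrArg Complex.re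
        (hw.sum_iteratedDeriv_eq_zero isOpen_univ (Set.mem_univ x))
      rw [Complex.re_sum, Complex.zero_re] at hsum
      rw [← hsum]
      refine Finset.sum_congr rfl fun m _ => ?_
      rw [hev.iteratedDeriv_eq, iteratedDeriv_re (hwc _).contDiffAt, ← mul_assoc]
      have hcast : (k.choose m : ℂ) * (-α ^ 2 : ℂ) ^ (k - m) =
          (((k.choose m : ℝ) * (-α ^ 2) ^ (k - m) : ℝ) : ℂ) := by push_cast; rfl
      rw [hcast, Complex.re_ofReal_mul]
end

section
/- There exist constants c > 0 and C > 0 (depending on k and α) such that |L_k(x)| ≤ C e^{−c|x|} for all x ∈ ℝ; that is, the fundamental function of k-hyperbolic cardinal spline interpolation decays exponentially. -/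
open MeasureTheory Filter
open scoped ENNReal

/-! ### Contour shifts in a horizontal strip -/

/-- A function holomorphic in a strip with decay `A / (1 + ξ ^ 2)` is integrable along every
horizontal line of the strip. -/
lemma integrable_horizontal {f : ℂ → ℂ} {c A : ℝ}
    (hf : ∀ z : ℂ, |z.im| ≤ c → DifferentiableAt ℂ f z)
    (hA : ∀ z : ℂ, |z.im| ≤ c → ‖f z‖ ≤ A * (1 + z.re ^ 2)⁻¹)
    {y : ℝ} (hy : |y| ≤ c) : Integrable (fun ξ : ℝ => f (ξ + y * Complex.I)) := by
  have hcont : Continuous (fun ξ : ℝ => f (ξ + y * Complex.I)) := by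
    rw [continuous_iff_continuousAt]
    intro ξ
    have h1 : ContinuousAt f ((ξ : ℂ) + y * Complex.I) := (hf _ (by simpa using hy)).continuousAt
    have h2 : ContinuousAt (fun ξ : ℝ => (ξ : ℂ) + y * Complex.I) ξ := by fun_prop
    exact ContinuousAt.comp (f := fun ξ : ℝ => (ξ : ℂ) + y * Complex.I) h1 h2
  refine (integrable_inv_one_add_sq.const_mul A).mono' hcont.aestronglyMeasurable ?_
  refine Eventually.of_forall fun ξ => ?_
  simpa using hA (ξ + y * Complex.I) (by simpa using hy)

/-- The integral over a vertical segment of a strip vanishes as the segment goes to infinity. -/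
lemma tendsto_vertical {f : ℂ → ℂ} {c A : ℝ}
    (hA : ∀ z : ℂ, |z.im| ≤ c → ‖f z‖ ≤ A * (1 + z.re ^ 2)⁻¹)
    {y : ℝ} (hy : |y| ≤ c) {u : ℝ → ℝ} (hu : ∀ R, u R ^ 2 = R ^ 2) :
    Tendsto (fun R : ℝ => ∫ t in (0 : ℝ)..y, f (u R + t * Complex.I)) atTop (nhds 0) := by
  have hbound : ∀ R : ℝ, ‖∫ t in (0 : ℝ)..y, f (u R + t * Complex.I)‖
      ≤ A * (1 + R ^ 2)⁻¹ * |y - 0| := by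
    intro R
    refine intervalIntegral.norm_integral_le_of_norm_le_const fun t ht => ?_
    have ht' : |t| ≤ c := by
      have h0 := Set.uIoc_subset_uIcc ht
      have h1 := Set.abs_sub_left_of_mem_uIcc h0
      simp only [sub_zero] at h1
      exact h1.trans hy
    simpa [hu] using hA (u R + t * Complex.I) (by simpa using ht')
  refine squeeze_zero_norm hbound ?_
  have h1 : Tendsto (fun R : ℝ => 1 + R ^ 2) atTop atTop :=
    tendsto_atTop_add_const_left _ _ (tendsto_pow_atTop two_ne_zero)
  simpa using (h1.inv_tendsto_atTop.const_mul A).mul_const |y - 0|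

/-- The integral along a horizontal line does not depend on the height of the line in the strip. -/
lemma integral_horizontal_shift {f : ℂ → ℂ} {c A : ℝ}
    (hf : ∀ z : ℂ, |z.im| ≤ c → DifferentiableAt ℂ f z)
    (hA : ∀ z : ℂ, |z.im| ≤ c → ‖f z‖ ≤ A * (1 + z.re ^ 2)⁻¹)
    {y : ℝ} (hy : |y| ≤ c) :
    ∫ ξ : ℝ, f ξ = ∫ ξ : ℝ, f (ξ + y * Complex.I) := by
  have h0 : |(0 : ℝ)| ≤ c := by simpa using (abs_nonneg y).trans hy
  have hbot : Integrable (fun ξ : ℝ => f ξ) := by simpa using integrable_horizontal hf hA h0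
  have htop := integrable_horizontal hf hA hy
  have hrect : ∀ R : ℝ, (∫ ξ in (-R)..R, f ξ) - (∫ ξ in (-R)..R, f (ξ + y * Complex.I))
      + Complex.I • (∫ t in (0 : ℝ)..y, f (R + t * Complex.I))
      - Complex.I • (∫ t in (0 : ℝ)..y, f ((-R : ℝ) + t * Complex.I)) = 0 := by
    intro R
    have h := Complex.integral_boundary_rect_eq_zero_of_differentiableOn f (-R : ℝ)
      (R + y * Complex.I) (fun z hz => by
        refine (hf z ?_).differentiableWithinAt
        have h1 := Set.abs_sub_left_of_mem_uIcc hz.2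
        simp at h1
        exact h1.trans hy)
    simpa using h
  have hlim := ((((intervalIntegral_tendsto_integral hbot tendsto_neg_atTop_atBot tendsto_id).sub
    (intervalIntegral_tendsto_integral htop tendsto_neg_atTop_atBot tendsto_id)).add
    ((tendsto_vertical hA hy (u := fun R => R) (fun R => rfl)).const_smul Complex.I)).sub
    ((tendsto_vertical hA hy (u := fun R => -R) (fun R => by ring)).const_smul Complex.I))
  have hzero := tendsto_nhds_unique (hlim.congr hrect) tendsto_const_nhds
  simpa [sub_eq_zero] using hzero

lemma norm_exp_I_mul_mul (x : ℝ) (z : ℂ) :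
    ‖Complex.exp (Complex.I * x * z)‖ = Real.exp (-(x * z.im)) := by
  rw [Complex.norm_exp]
  congr 1
  simp

/-- A Paley–Wiener bound: the Fourier integral of a function that is holomorphic with quadratic
decay in a strip of half-width `c` decays like `exp (-c |x|)`. -/
lemma norm_fourier_integral_le_of_strip {f : ℂ → ℂ} {c A : ℝ} (hc : 0 ≤ c)
    (hf : ∀ z : ℂ, |z.im| ≤ c → DifferentiableAt ℂ f z)
    (hA : ∀ z : ℂ, |z.im| ≤ c → ‖f z‖ ≤ A * (1 + z.re ^ 2)⁻¹) (x : ℝ) :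
    ‖∫ ξ : ℝ, f ξ * Complex.exp (Complex.I * x * ξ)‖ ≤ A * Real.pi * Real.exp (-c * |x|) := by
  obtain ⟨y, hy, hxy⟩ : ∃ y : ℝ, |y| ≤ c ∧ x * y = c * |x| := by
    rcases le_total 0 x with h | h
    · exact ⟨c, (abs_of_nonneg hc).le, by rw [abs_of_nonneg h]; ring⟩
    · exact ⟨-c, by rw [abs_neg, abs_of_nonneg hc], by rw [abs_of_nonpos h]; ring⟩
  have hshift := integral_horizontal_shift
    (f := fun z => f z * Complex.exp (Complex.I * x * z)) (c := c)
    (A := A * Real.exp (|x| * c)) (fun z hz => (hf z hz).mul (by fun_prop))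
    (fun z hz => by
      rw [norm_mul, norm_exp_I_mul_mul, mul_right_comm]
      have h1 : -(x * z.im) ≤ |x| * c := by
        calc -(x * z.im) ≤ |x * z.im| := neg_le_abs _
          _ = |x| * |z.im| := abs_mul _ _
          _ ≤ |x| * c := by gcongr
      have h2 := hA z hz
      have h3 := (norm_nonneg _).trans h2
      gcongr) hy
  rw [hshift]
  have hbound : ∀ ξ : ℝ, ‖f (ξ + y * Complex.I) *
      Complex.exp (Complex.I * x * (ξ + y * Complex.I))‖
      ≤ A * Real.exp (-c * |x|) * (1 + ξ ^ 2)⁻¹ := by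
    intro ξ
    rw [norm_mul, norm_exp_I_mul_mul, mul_right_comm]
    have h2 := hA (ξ + y * Complex.I) (by simpa using hy)
    have h3 : -(x * ((ξ : ℂ) + y * Complex.I).im) = -c * |x| := by simp [hxy]
    rw [h3]
    gcongr
    simpa using h2
  refine (norm_integral_le_of_norm_le (integrable_inv_one_add_sq.const_mul _)
    (Eventually.of_forall hbound)).trans_eq ?_
  rw [integral_const_mul, integral_univ_inv_one_add_sq]
  ring

/-! ### Holomorphic extension of the symbol -/

/-- The holomorphic extension of `ξ ↦ (ξ ^ 2 + α ^ 2) ^ (-k)`. -/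
noncomputable def kernelC (α : ℝ) (k : ℕ) (z : ℂ) : ℂ := ((z ^ 2 + (α : ℂ) ^ 2) ^ k)⁻¹

/-- The holomorphic extension of `S`. -/
noncomputable def periodizedC (α : ℝ) (k : ℕ) (z : ℂ) : ℂ :=
  ∑' j : ℤ, kernelC α k (z - 2 * Real.pi * j)

section

variable {α : ℝ} {k : ℕ}

lemma re_sq_add_le_norm {z : ℂ} (hz : |z.im| < α / 2) :
    z.re ^ 2 + α ^ 2 / 2 ≤ ‖z ^ 2 + (α : ℂ) ^ 2‖ := by
  refine le_trans ?_ (Complex.re_le_norm _)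
  have h1 : (z ^ 2 + (α : ℂ) ^ 2).re = z.re ^ 2 - z.im ^ 2 + α ^ 2 := by
    simp [pow_two]
  have h2 := abs_lt.1 hz
  rw [h1]
  nlinarith

lemma sq_add_sq_ne_zero (hα : 0 < α) {z : ℂ} (hz : |z.im| < α / 2) : z ^ 2 + (α : ℂ) ^ 2 ≠ 0 := by
  rw [← norm_pos_iff]
  exact lt_of_lt_of_le (by positivity) (re_sq_add_le_norm hz)

lemma differentiableAt_kernelC (hα : 0 < α) {z : ℂ} (hz : |z.im| < α / 2) :
    DifferentiableAt ℂ (kernelC α k) z := by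
  unfold kernelC
  exact DifferentiableAt.inv (by fun_prop) (pow_ne_zero _ (sq_add_sq_ne_zero hα hz))

lemma exists_norm_kernelC_le (hα : 0 < α) (hk : 1 ≤ k) :
    ∃ M > (0 : ℝ), ∀ z : ℂ, |z.im| < α / 2 → ‖kernelC α k z‖ ≤ M * (1 + z.re ^ 2)⁻¹ := by
  set D : ℝ := min 1 (α ^ 2 / 2)
  have hD : 0 < D := lt_min one_pos (by positivity)
  refine ⟨(D ^ k)⁻¹, by positivity, fun z hz => ?_⟩
  rw [kernelC, norm_inv, norm_pow, ← mul_inv]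
  have h1 : D * (1 + z.re ^ 2) ≤ ‖z ^ 2 + (α : ℂ) ^ 2‖ := by
    refine le_trans ?_ (re_sq_add_le_norm hz)
    nlinarith [min_le_left 1 (α ^ 2 / 2), min_le_right 1 (α ^ 2 / 2), sq_nonneg z.re]
  refine inv_anti₀ (by positivity) ?_
  calc D ^ k * (1 + z.re ^ 2) ≤ D ^ k * (1 + z.re ^ 2) ^ k := by
        gcongr
        exact le_self_pow₀ (by nlinarith [sq_nonneg z.re]) (by omega)
    _ = (D * (1 + z.re ^ 2)) ^ k := (mul_pow _ _ _).symm
    _ ≤ _ := by gcongr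

lemma re_sub_two_pi_mul_int (z : ℂ) (j : ℤ) :
    (z - 2 * Real.pi * j).re = z.re - 2 * Real.pi * j := by simp

lemma im_sub_two_pi_mul_int (z : ℂ) (j : ℤ) : (z - 2 * Real.pi * j).im = z.im := by simp

lemma inv_one_add_sq_shift_le {x R : ℝ} (hx : |x| < R) (j : ℤ) :
    (1 + (x - 2 * Real.pi * j) ^ 2)⁻¹ ≤ (2 + 2 * R ^ 2) * (1 / |(j : ℝ) + 1 / 2| ^ (2 : ℝ)) := by
  have hj : (j : ℝ) + 1 / 2 ≠ 0 := by
    intro h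
    have h1 : (2 : ℝ) * j + 1 = 0 := by linarith
    have h2 : 2 * j + 1 = 0 := by exact_mod_cast h1
    omega
  have hpos : 0 < ((j : ℝ) + 1 / 2) ^ 2 := by positivity
  rw [Real.rpow_two, sq_abs, mul_one_div, inv_eq_one_div, div_le_div_iff₀ (by positivity) hpos]
  have hxR : x ^ 2 ≤ R ^ 2 := by
    rw [← sq_abs x]
    exact pow_le_pow_left₀ (abs_nonneg x) hx.le 2
  have h1 : 4 * Real.pi ^ 2 * (j : ℝ) ^ 2 ≤ 2 * (x - 2 * Real.pi * j) ^ 2 + 2 * x ^ 2 := by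
    nlinarith [sq_nonneg (x - 2 * Real.pi * j + x)]
  have h2 : 2 * (j : ℝ) ^ 2 ≤ 4 * Real.pi ^ 2 * (j : ℝ) ^ 2 := by
    gcongr
    nlinarith [Real.pi_gt_three]
  nlinarith [sq_nonneg ((j : ℝ) - 1 / 2), mul_nonneg (sq_nonneg R)
    (sq_nonneg (x - 2 * Real.pi * j))]

/-- A summable majorant of the terms of `periodizedC`, uniform on bounded parts of the strip. -/
lemma exists_summable_majorant (hα : 0 < α) (hk : 1 ≤ k) (R : ℝ) :
    ∃ u : ℤ → ℝ, Summable u ∧ ∀ (j : ℤ) (z : ℂ), |z.re| < R → |z.im| < α / 2 →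
      ‖kernelC α k (z - 2 * Real.pi * j)‖ ≤ u j := by
  obtain ⟨M, hM, hMz⟩ := exists_norm_kernelC_le hα hk
  refine ⟨fun j => M * ((2 + 2 * R ^ 2) * (1 / |(j : ℝ) + 1 / 2| ^ (2 : ℝ))), ?_, ?_⟩
  · exact (((Real.summable_one_div_int_add_rpow (1 / 2) 2).2 one_lt_two).mul_left _).mul_left _
  · intro j z hre him
    have h := hMz (z - 2 * Real.pi * j) (by rwa [im_sub_two_pi_mul_int])
    rw [re_sub_two_pi_mul_int] at h
    exact h.trans (mul_le_mul_of_nonneg_left (inv_one_add_sq_shift_le hre j) hM.le)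

lemma differentiableAt_periodizedC (hα : 0 < α) (hk : 1 ≤ k) {z : ℂ} (hz : |z.im| < α / 2) :
    DifferentiableAt ℂ (periodizedC α k) z := by
  obtain ⟨u, hu, hbound⟩ := exists_summable_majorant hα hk (|z.re| + 1)
  have hopen : IsOpen {w : ℂ | |w.re| < |z.re| + 1 ∧ |w.im| < α / 2} :=
    (isOpen_lt (f := fun w : ℂ => |w.re|) (by fun_prop) continuous_const).inter
      (isOpen_lt (f := fun w : ℂ => |w.im|) (by fun_prop) continuous_const)
  have hd := Complex.differentiableOn_tsum_of_summable_norm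
    (F := fun (j : ℤ) z => kernelC α k (z - 2 * Real.pi * j)) hu
    (fun j w hw => by
      refine DifferentiableAt.differentiableWithinAt ?_
      have h1 := differentiableAt_kernelC (k := k) hα (z := w - 2 * Real.pi * j)
        (by rw [im_sub_two_pi_mul_int]; exact hw.2)
      exact DifferentiableAt.comp (g := kernelC α k) w h1 (by fun_prop))
    hopen (fun j w hw => hbound j w hw.1 hw.2)
  exact hd.differentiableAt (hopen.mem_nhds ⟨lt_add_one _, hz⟩)

lemma periodizedC_sub_two_pi_mul_int (z : ℂ) (n : ℤ) :
    periodizedC α k (z - 2 * Real.pi * n) = periodizedC α k z := by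
  unfold periodizedC
  rw [← (Equiv.addLeft n).tsum_eq (fun j : ℤ => kernelC α k (z - 2 * Real.pi * j))]
  congr 1
  funext j
  congr 1
  simp only [Equiv.coe_addLeft]
  push_cast
  ring

lemma kernelC_ofReal_sub (ξ : ℝ) (j : ℤ) : kernelC α k ((ξ : ℂ) - 2 * Real.pi * j) =
    (((((ξ - 2 * Real.pi * j) ^ 2 + α ^ 2) ^ k)⁻¹ : ℝ) : ℂ) := by
  simp [kernelC]

lemma periodizedC_ofReal (ξ : ℝ) : periodizedC α k ξ = (S α k ξ : ℂ) := by
  simp only [periodizedC, S, kernelC_ofReal_sub, Complex.ofReal_tsum]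

/-- In some closed strip around the real axis `periodizedC` is bounded away from zero. -/
lemma exists_strip_norm_inv_periodizedC_le (hα : 0 < α) (hk : 1 ≤ k) :
    ∃ c > (0 : ℝ), c < α / 2 ∧ ∃ B > (0 : ℝ), ∀ z : ℂ, |z.im| ≤ c →
      periodizedC α k z ≠ 0 ∧ ‖(periodizedC α k z)⁻¹‖ ≤ B := by
  have hstrip : IsOpen {z : ℂ | |z.im| < α / 2} := isOpen_lt (by fun_prop) (by fun_prop)
  have hcont : ContinuousOn (periodizedC α k) {z : ℂ | |z.im| < α / 2} := fun z hz =>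
    (differentiableAt_periodizedC hα hk hz).continuousAt.continuousWithinAt
  have hopen := hcont.isOpen_inter_preimage hstrip (isOpen_compl_singleton (x := (0 : ℂ)))
  have hseg : IsCompact ((fun x : ℝ => (x : ℂ)) '' Set.Icc (-Real.pi) Real.pi) :=
    isCompact_Icc.image Complex.continuous_ofReal
  obtain ⟨ε, hε, hsub⟩ := hseg.exists_cthickening_subset_open hopen (by
    rintro _ ⟨x, -, rfl⟩
    refine ⟨by simpa using hα, ?_⟩
    simpa [periodizedC_ofReal] using (S_pos hα hk x).ne')
  have hmem : ∀ z : ℂ, z.re ∈ Set.Icc (-Real.pi) Real.pi → |z.im| ≤ ε →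
      |z.im| < α / 2 ∧ periodizedC α k z ≠ 0 := by
    intro z hre him
    refine hsub (Metric.mem_cthickening_of_dist_le z (z.re : ℂ) _ _ ⟨z.re, hre, rfl⟩ ?_)
    rwa [Complex.dist_of_re_eq (by simp), Complex.ofReal_im, Real.dist_0_eq_abs]
  have hεα : ε < α / 2 := by
    have := (hmem (ε * Complex.I) (by simp [Real.pi_pos.le])
      (by simp [abs_of_pos hε])).1
    simpa [abs_of_pos hε] using this
  have hbox : IsCompact (Set.Icc (-Real.pi) Real.pi ×ℂ Set.Icc (-ε) ε) :=
    isCompact_Icc.reProdIm isCompact_Icc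
  obtain ⟨B, hB⟩ := hbox.exists_bound_of_continuousOn (f := fun z => (periodizedC α k z)⁻¹)
    (fun z hz => by
      obtain ⟨h1, h2⟩ := hmem z hz.1 (abs_le.2 hz.2)
      exact ((differentiableAt_periodizedC hα hk h1).continuousAt.inv₀ h2).continuousWithinAt)
  refine ⟨ε, hε, hεα, max B 1, by positivity, fun z hz => ?_⟩
  obtain ⟨n, hn, -⟩ := existsUnique_sub_zsmul_mem_Ico Real.two_pi_pos z.re (-Real.pi)
  have hre : (z - 2 * Real.pi * n).re ∈ Set.Icc (-Real.pi) Real.pi := by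
    rw [re_sub_two_pi_mul_int]
    simp only [zsmul_eq_mul, Set.mem_Ico] at hn
    constructor <;> linarith [hn.1, hn.2]
  have him : |(z - 2 * Real.pi * n).im| ≤ ε := by rwa [im_sub_two_pi_mul_int]
  rw [← periodizedC_sub_two_pi_mul_int z n]
  exact ⟨(hmem _ hre him).2, (hB _ ⟨hre, abs_le.1 him⟩).trans (le_max_left _ _)⟩

lemma Lhat_eq_complex (ξ : ℝ) : (Lhat α k ξ : ℂ) =
    ((Real.sqrt (2 * Real.pi))⁻¹ : ℝ) * (kernelC α k ξ * (periodizedC α k ξ)⁻¹) := by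
  rw [periodizedC_ofReal, Lhat, kernelC]
  push_cast
  ring

end

/-- The fundamental function of k-hyperbolic cardinal spline
interpolation decays exponentially. -/
theorem stmt_5 (α : ℝ) (hα : 0 < α) (k : ℕ) (hk : 1 ≤ k) :
    ∃ c > (0 : ℝ), ∃ C > (0 : ℝ), ∀ x : ℝ,
      |Lk α k x| ≤ C * Real.exp (-c * |x|) := by
  obtain ⟨c, hc, hcα, B, hB, hstrip⟩ := exists_strip_norm_inv_periodizedC_le hα hk
  obtain ⟨M, hM, hkernel⟩ := exists_norm_kernelC_le hα hk
  set q : ℝ := (Real.sqrt (2 * Real.pi))⁻¹ with hq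
  have hq0 : 0 < q := by positivity
  refine ⟨c, hc, q * (q * (M * B) * Real.pi), by positivity, fun x => ?_⟩
  have hdecay := norm_fourier_integral_le_of_strip
    (f := fun z => (q : ℂ) * (kernelC α k z * (periodizedC α k z)⁻¹)) (A := q * (M * B)) hc.le
    (fun z hz => ((differentiableAt_kernelC hα (hz.trans_lt hcα)).mul
      ((differentiableAt_periodizedC hα hk (hz.trans_lt hcα)).inv (hstrip z hz).1)).const_mul _)
    (fun z hz => by
      rw [norm_mul, norm_mul, Complex.norm_real, Real.norm_of_nonneg hq0.le]
      calc q * (‖kernelC α k z‖ * ‖(periodizedC α k z)⁻¹‖)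
          ≤ q * (M * (1 + z.re ^ 2)⁻¹ * B) := by
            gcongr
            · exact hkernel z (hz.trans_lt hcα)
            · exact (hstrip z hz).2
        _ = q * (M * B) * (1 + z.re ^ 2)⁻¹ := by ring) x
  simp only [hq, ← Lhat_eq_complex] at hdecay
  rw [← hq] at hdecay
  refine (Complex.abs_re_le_norm _).trans ?_
  rw [norm_mul, ← Complex.ofReal_inv, ← hq, Complex.norm_real, Real.norm_of_nonneg hq0.le,
    mul_assoc q]
  gcongr
end

section
/- Let b = {b_j : j ∈ ℤ} be a sequence of polynomial growth, i.e. there exist C > 0 and β > 0 with |b_j| ≤ C(1 + |j|)^β for all j, and let f_b(x) = Σ_{j∈ℤ} b_j L_k(x − j). Then f_b is a k-hyperbolic cardinal spline and f_b(j) = b_j for every j ∈ ℤ. -/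
open MeasureTheory Filter
open scoped ENNReal

section

open Polynomial Topology FourierTransform

/-- The exponential polynomial `x ↦ p(x) e^{cx}`, as a linear function of `p`. -/
noncomputable def expPoly (c : ℝ) : ℝ[X] →ₗ[ℝ] (ℝ → ℝ) where
  toFun p x := p.eval x * Real.exp (c * x)
  map_add' p q := by ext x; simp [add_mul]
  map_smul' r p := by ext x; simp [mul_assoc]

lemma expPoly_apply (c : ℝ) (p : ℝ[X]) (x : ℝ) :
    expPoly c p x = p.eval x * Real.exp (c * x) := rfl

lemma contDiff_expPoly (c : ℝ) (p : ℝ[X]) {n : WithTop ℕ∞} : ContDiff ℝ n (expPoly c p) := by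
  have : expPoly c p = fun x => p.eval x * Real.exp (c * x) := rfl
  rw [this]
  exact ContDiff.mul (p.contDiff_aeval n) (by fun_prop)

lemma iteratedDeriv_expPoly (c : ℝ) (p : ℝ[X]) (n : ℕ) :
    iteratedDeriv n (expPoly c p) =
      expPoly c (((Polynomial.derivative + c • 1 : Module.End ℝ ℝ[X]) ^ n) p) := by
  induction n with
  | zero => simp
  | succ n ih =>
    rw [iteratedDeriv_succ, ih, pow_succ']
    set q := ((Polynomial.derivative + c • 1 : Module.End ℝ ℝ[X]) ^ n) p
    ext x
    have h : HasDerivAt (expPoly c q)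
        (q.derivative.eval x * Real.exp (c * x) + q.eval x * (Real.exp (c * x) * (c * 1))) x :=
      (q.hasDerivAt x).mul ((hasDerivAt_id x).const_mul c).exp
    rw [h.deriv]
    simp [expPoly_apply]
    ring

lemma sum_iteratedDeriv_expPoly_eq_zero {α c : ℝ} (hc : c ^ 2 = α ^ 2) {k : ℕ} {p : ℝ[X]}
    (hp : p ∈ degreeLT ℝ k) (x : ℝ) :
    ∑ m ∈ Finset.range (k + 1),
      (k.choose m : ℝ) * (-α ^ 2) ^ (k - m) * iteratedDeriv (2 * m) (expPoly c p) x = 0 := by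
  set D : Module.End ℝ ℝ[X] := Polynomial.derivative with hD
  set T : Module.End ℝ ℝ[X] := D + c • 1 with hT
  have hfac : T ^ 2 + (-α ^ 2) • (1 : Module.End ℝ ℝ[X]) = (D + (2 * c) • 1) * D := by
    rw [hT, ← hc]
    simp only [pow_two, add_mul, mul_add, smul_mul_assoc, one_mul, mul_smul_comm, mul_one]
    module
  have hcomm : Commute (D + (2 * c) • (1 : Module.End ℝ ℝ[X])) D :=
    (Commute.refl D).add_left ((Commute.one_left D).smul_left _)
  have hkill : ((T ^ 2 + (-α ^ 2) • (1 : Module.End ℝ ℝ[X])) ^ k) p = 0 := by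
    rw [hfac, hcomm.mul_pow, Module.End.mul_apply]
    have : (D ^ k) p = 0 := by
      rw [Module.End.pow_apply]
      exact iterate_derivative_eq_zero_of_degree_lt (mem_degreeLT.1 hp)
    rw [this, map_zero]
  have hexp : (T ^ 2 + (-α ^ 2) • (1 : Module.End ℝ ℝ[X])) ^ k =
      ∑ m ∈ Finset.range (k + 1), ((k.choose m : ℝ) * (-α ^ 2) ^ (k - m)) • T ^ (2 * m) := by
    rw [Commute.add_pow ((Commute.one_right _).smul_right _)]
    refine Finset.sum_congr rfl fun m _ => ?_
    rw [_root_.smul_pow, one_pow, ← pow_mul, mul_smul_comm, mul_one, smul_mul_assoc, mul_smul,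
      smul_comm, ← nsmul_eq_mul', Nat.cast_smul_eq_nsmul]
  rw [hexp] at hkill
  have := congrFun (congrArg (expPoly c) hkill) x
  simp only [LinearMap.sum_apply, LinearMap.smul_apply, map_sum, map_smul, map_zero,
    Finset.sum_apply, Pi.smul_apply, Pi.zero_apply, smul_eq_mul] at this
  simpa only [iteratedDeriv_expPoly] using this

lemma expPoly_comp_sub {c : ℝ} {k : ℕ} {p : ℝ[X]} (hp : p ∈ degreeLT ℝ k) (r : ℝ) :
    (fun x => expPoly c p (x - r)) ∈ (degreeLT ℝ k).map (expPoly c) := by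
  refine ⟨Real.exp (-(c * r)) • p.comp (X - C r), Submodule.smul_mem _ _ ?_, ?_⟩
  · rw [mem_degreeLT] at *
    rcases eq_or_ne p 0 with rfl | h0
    · simp
    · have : (p.comp (X - C r)).natDegree = p.natDegree := by simp [natDegree_comp]
      have h1 : p.natDegree < k := (natDegree_lt_iff_degree_lt h0).2 hp
      exact degree_le_natDegree.trans_lt (by rw [this]; exact_mod_cast h1)
  · ext x
    rw [map_smul, Pi.smul_apply, expPoly_apply, expPoly_apply, mul_sub, sub_eq_add_neg (c * x),
      Real.exp_add]
    simp only [eval_comp, eval_sub, eval_X, eval_C, smul_eq_mul]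
    ring

/-- Exponential polynomials of bounded degree are closed under pointwise convergent sums. -/
lemma tsum_mem_expPoly {ι : Type*} {c : ℝ} {k : ℕ} {f : ι → ℝ → ℝ}
    (hf : ∀ i, f i ∈ (degreeLT ℝ k).map (expPoly c)) (hs : ∀ x, Summable fun i => f i x) :
    (fun x => ∑' i, f i x) ∈ (degreeLT ℝ k).map (expPoly c) := by
  have : FiniteDimensional ℝ (degreeLT ℝ k) :=
    Module.Finite.equiv (degreeLTEquiv ℝ k).symm
  have hcl := ((degreeLT ℝ k).map (expPoly c)).closed_of_finiteDimensional
  have hsum : HasSum f (fun x => ∑' i, f i x) := Pi.hasSum.2 fun x => (hs x).hasSum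
  exact hcl.mem_of_tendsto hsum (Eventually.of_forall fun s => Submodule.sum_mem _ fun i _ => hf i)

lemma Polynomial.exists_abs_eval_le (p : ℝ[X]) :
    ∃ K, 0 ≤ K ∧ ∀ x : ℝ, |p.eval x| ≤ K * (1 + |x|) ^ p.natDegree := by
  refine ⟨∑ i ∈ Finset.range (p.natDegree + 1), |p.coeff i|,
    Finset.sum_nonneg fun _ _ => abs_nonneg _, fun x => ?_⟩
  rw [eval_eq_sum_range, Finset.sum_mul]
  refine (Finset.abs_sum_le_sum_abs _ _).trans (Finset.sum_le_sum fun i hi => ?_)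
  rw [abs_mul, abs_pow]
  gcongr ?_ * ?_
  calc |x| ^ i ≤ (1 + |x|) ^ i := by gcongr; linarith
    _ ≤ _ := pow_le_pow_right₀ (by linarith [abs_nonneg x]) (by simpa [Nat.lt_succ_iff] using hi)

lemma one_add_abs_le_mul (x y : ℝ) : 1 + |x + y| ≤ (1 + |x|) * (1 + |y|) := by
  nlinarith [abs_add_le x y, mul_nonneg (abs_nonneg x) (abs_nonneg y)]

lemma summable_one_add_abs_pow_mul_exp {α : ℝ} (hα : 0 < α) (M : ℕ) :
    Summable fun m : ℤ => (1 + |(m : ℝ)|) ^ M * Real.exp (-(α * |(m : ℝ)|)) := by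
  have key : Summable fun n : ℕ => (1 + (n : ℝ)) ^ M * Real.exp (-(α * (n : ℝ))) := by
    have h : Summable fun n : ℕ => (n : ℝ) ^ M * Real.exp (-α) ^ n :=
      summable_pow_mul_geometric_of_norm_lt_one M (by simpa using hα)
    have h' := ((summable_nat_add_iff 1).2 h).mul_left (Real.exp α)
    refine h'.congr fun n => ?_
    rw [← Real.exp_nat_mul, mul_left_comm, ← Real.exp_add]
    push_cast
    rw [add_comm (n : ℝ) 1]
    congr 2
    ring
  refine Summable.of_nat_of_neg ?_ ?_ <;> simpa using key

lemma exp_neg_abs_sub_le {α : ℝ} (hα : 0 < α) (x y : ℝ) :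
    Real.exp (-(α * |x - y|)) ≤ Real.exp (α * |x|) * Real.exp (-(α * |y|)) := by
  rw [← Real.exp_add]
  have := abs_sub_abs_le_abs_sub y x
  rw [abs_sub_comm] at this
  exact Real.exp_le_exp.2 (by nlinarith)

/-- A sequence of polynomial growth times a polynomial in `x - m` times a factor of size
`e^{-α|m|}` is summable. -/
lemma summable_polyGrowth_mul {α : ℝ} (hα : 0 < α) {d : ℤ → ℝ} {K : ℝ} {N : ℕ}
    (hd : ∀ m, |d m| ≤ K * (1 + |(m : ℝ)|) ^ N) (p : ℝ[X]) {B : ℝ} {y w : ℤ → ℝ} {R : ℝ}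
    (hy : ∀ m, |y m| ≤ R + |(m : ℝ)|)
    (hw : ∀ m, |w m| ≤ B * Real.exp (-(α * |(m : ℝ)|))) :
    Summable fun m => d m * (p.eval (y m) * w m) := by
  obtain ⟨A, hA, hp⟩ := p.exists_abs_eval_le
  refine Summable.of_norm_bounded (((summable_one_add_abs_pow_mul_exp hα
    (N + p.natDegree)).mul_left (K * (A * (1 + |R|) ^ p.natDegree) * B))) fun m => ?_
  have h1 : 1 + |y m| ≤ (1 + |R|) * (1 + |(m : ℝ)|) := by
    have := hy m
    nlinarith [le_abs_self R, mul_nonneg (abs_nonneg R) (abs_nonneg (m : ℝ))]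
  have h2 : |p.eval (y m)| ≤ A * ((1 + |R|) * (1 + |(m : ℝ)|)) ^ p.natDegree :=
    (hp _).trans (by gcongr)
  have hK : 0 ≤ K * (1 + |(m : ℝ)|) ^ N := (abs_nonneg _).trans (hd m)
  rw [Real.norm_eq_abs, abs_mul, abs_mul]
  calc _ ≤ (K * (1 + |(m : ℝ)|) ^ N) * ((A * ((1 + |R|) * (1 + |(m : ℝ)|)) ^ p.natDegree) *
        (B * Real.exp (-(α * |(m : ℝ)|)))) := by
        gcongr
        · exact hd m
        · exact hw m
    _ = _ := by rw [mul_pow, pow_add]; ring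

/-- The even exponential polynomial `x ↦ p(|x|) e^{-α|x|}`. -/
noncomputable def evenExpPoly (α : ℝ) (p : ℝ[X]) (x : ℝ) : ℝ :=
  p.eval |x| * Real.exp (-(α * |x|))

lemma continuous_evenExpPoly (α : ℝ) (p : ℝ[X]) : Continuous (evenExpPoly α p) := by
  unfold evenExpPoly
  fun_prop

lemma evenExpPoly_neg (α : ℝ) (p : ℝ[X]) (x : ℝ) :
    evenExpPoly α p (-x) = evenExpPoly α p x := by
  simp [evenExpPoly]

lemma summable_mul_evenExpPoly {α : ℝ} (hα : 0 < α) (p : ℝ[X]) {d : ℤ → ℝ} {K : ℝ} {N : ℕ}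
    (hd : ∀ m, |d m| ≤ K * (1 + |(m : ℝ)|) ^ N) (x : ℝ) :
    Summable fun m : ℤ => d m * evenExpPoly α p (x - m) := by
  refine summable_polyGrowth_mul hα hd p (R := |x|) (y := fun m => |x - m|)
    (B := Real.exp (α * |x|)) (fun m => ?_) fun m => ?_
  · rw [abs_abs]; exact abs_sub x m
  · rw [abs_of_pos (Real.exp_pos _)]
    exact exp_neg_abs_sub_le hα x m

lemma integrableOn_pow_mul_exp (n : ℕ) {r : ℝ} (hr : 0 < r) :
    IntegrableOn (fun x : ℝ => x ^ n * Real.exp (-(r * x))) (Set.Ioi 0) := by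
  have := integrableOn_rpow_mul_exp_neg_mul_rpow (p := 1) (s := n) (b := r)
    (by linarith [n.cast_nonneg (α := ℝ)]) one_pos hr
  simpa using this

lemma integrableOn_pow_mul_cexp (n : ℕ) {r : ℂ} (hr : 0 < r.re) :
    IntegrableOn (fun x : ℝ => (x : ℂ) ^ n * Complex.exp (-(r * x))) (Set.Ioi 0) := by
  refine (integrableOn_pow_mul_exp n hr).mono' (by fun_prop) ?_
  refine (ae_restrict_iff' measurableSet_Ioi).2 (Eventually.of_forall fun x hx => ?_)
  have hx : (0 : ℝ) < x := hx
  simp [Complex.norm_exp, abs_of_pos hx]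

lemma integral_pow_mul_cexp (n : ℕ) {r : ℂ} (hr : 0 < r.re) :
    ∫ x in Set.Ioi (0 : ℝ), (x : ℂ) ^ n * Complex.exp (-(r * x)) =
      (n.factorial : ℂ) * r⁻¹ ^ (n + 1) := by
  have hr0 : r ≠ 0 := fun h => by simp [h] at hr
  have hlim (m : ℕ) : Tendsto (fun x : ℝ => -(x : ℂ) ^ m * Complex.exp (-(r * x)) * r⁻¹) atTop
      (𝓝 0) := by
    rw [tendsto_zero_iff_norm_tendsto_zero]
    have := (isLittleO_pow_exp_pos_mul_atTop m hr).tendsto_div_nhds_zero.norm.mul_const ‖r⁻¹‖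
    simp only [norm_zero, zero_mul] at this
    refine this.congr fun x => ?_
    simp [Complex.norm_exp, Real.exp_neg, div_eq_mul_inv]
  have hexp (x : ℝ) : HasDerivAt (fun x : ℝ => Complex.exp (-(r * x)))
      (Complex.exp (-(r * x)) * -(r * 1)) x :=
    ((Complex.ofRealCLM.hasDerivAt (x := x)).const_mul r).neg.cexp
  induction n with
  | zero =>
    have h := integral_Ioi_of_hasDerivAt_of_tendsto' (a := (0 : ℝ))
      (f := fun x : ℝ => -(x : ℂ) ^ 0 * Complex.exp (-(r * x)) * r⁻¹)
      (f' := fun x : ℝ => (x : ℂ) ^ 0 * Complex.exp (-(r * x))) (fun x _ => ?_)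
      (integrableOn_pow_mul_cexp 0 hr) (hlim 0)
    · rw [h]; simp
    · refine (((hexp x).const_mul (-1)).mul_const r⁻¹).congr_deriv ?_ |>.congr_of_eventuallyEq ?_
      · field_simp
      · exact Eventually.of_forall fun y => by simp
  | succ n ih =>
    have hi := (integrableOn_pow_mul_cexp n hr).const_mul ((n + 1 : ℂ) * r⁻¹)
    have h := integral_Ioi_of_hasDerivAt_of_tendsto' (a := (0 : ℝ))
      (f := fun x : ℝ => -(x : ℂ) ^ (n + 1) * Complex.exp (-(r * x)) * r⁻¹)
      (f' := fun x : ℝ => (x : ℂ) ^ (n + 1) * Complex.exp (-(r * x)) -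
        (n + 1 : ℂ) * r⁻¹ * ((x : ℂ) ^ n * Complex.exp (-(r * x)))) (fun x _ => ?_)
      ((integrableOn_pow_mul_cexp (n + 1) hr).sub hi) (hlim (n + 1))
    · rw [integral_sub (integrableOn_pow_mul_cexp (n + 1) hr) hi, integral_const_mul, ih] at h
      rw [sub_eq_iff_eq_add.1 h]
      push_cast [Nat.factorial_succ]
      simp
      ring
    · have hpow := ((Complex.ofRealCLM.hasDerivAt (x := x)).pow (n + 1)).neg
      refine ((hpow.mul (hexp x)).mul_const r⁻¹).congr_deriv ?_
      simp
      field_simp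
      ring

/-- Partial fractions: if `s` and `t` satisfy `2α st = s + t`, a monomial in `s` and `t` is a sum
of a polynomial in `s` and a polynomial in `t` without constant terms. -/
lemma exists_partialFractions {α : ℝ} (hα : 0 < α) (a b : ℕ) (hab : a + b ≠ 0) :
    ∃ P ∈ degreeLT ℝ a, ∃ Q ∈ degreeLT ℝ b, ∀ s t : ℂ, 2 * α * (s * t) = s + t →
      s ^ a * t ^ b = s * aeval s P + t * aeval t Q := by
  induction a generalizing b with
  | zero =>
    obtain ⟨b, rfl⟩ := Nat.exists_eq_succ_of_ne_zero (by omega : b ≠ 0)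
    exact ⟨0, by simp, X ^ b, mem_degreeLT.2 (by simpa using by exact_mod_cast b.lt_succ_self),
      fun s t _ => by simp [pow_succ']⟩
  | succ a iha =>
    induction b with
    | zero =>
      exact ⟨X ^ a, mem_degreeLT.2 (by simpa using by exact_mod_cast a.lt_succ_self), 0, by simp,
        fun s t _ => by simp [pow_succ']⟩
    | succ b ihb =>
      obtain ⟨P, hP, Q, hQ, h⟩ := ihb (by omega)
      obtain ⟨P', hP', Q', hQ', h'⟩ := iha (b + 1) (by omega)
      refine ⟨(2 * α)⁻¹ • (P + P'), Submodule.smul_mem _ _ (Submodule.add_mem _ hP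
        (degreeLT_mono a.le_succ hP')), (2 * α)⁻¹ • (Q + Q'), Submodule.smul_mem _ _
        (Submodule.add_mem _ (degreeLT_mono b.le_succ hQ) hQ'), fun s t hst => ?_⟩
      have hα₀ : (α : ℂ) ≠ 0 := by exact_mod_cast hα.ne'
      have hα' : (2 * α : ℂ) ≠ 0 := mul_ne_zero two_ne_zero hα₀
      have e1 := h s t hst
      have e2 := h' s t hst
      have e3 : 2 * α * (s ^ (a + 1) * t ^ (b + 1)) = s ^ (a + 1) * t ^ b + s ^ a * t ^ (b + 1) := by
        linear_combination (s ^ a * t ^ b) * hst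
      rw [e1, e2] at e3
      apply mul_left_cancel₀ hα'
      rw [e3]
      simp only [map_smul, map_add, Complex.real_smul]
      push_cast
      field_simp
      ring

/-- The rescaled symbol `v ↦ ((2πv)² + α²)^{-k}`. -/
noncomputable def symbol (α : ℝ) (k : ℕ) (v : ℝ) : ℝ :=
  (((2 * Real.pi * v) ^ 2 + α ^ 2) ^ k)⁻¹

lemma symbol_eq_sum {α : ℝ} (hα : 0 < α) {k : ℕ} (hk : 1 ≤ k) :
    ∃ c : ℕ → ℝ, ∀ v : ℝ, (symbol α k v : ℂ) = ∑ i ∈ Finset.range k, (c i : ℂ) *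
      (((α + 2 * Real.pi * v * Complex.I)⁻¹) ^ (i + 1) +
        ((α - 2 * Real.pi * v * Complex.I)⁻¹) ^ (i + 1)) := by
  obtain ⟨P, hP, Q, hQ, h⟩ := exists_partialFractions hα k k (by omega)
  have hdeg : (P + Q).natDegree < k := by
    rcases eq_or_ne (P + Q) 0 with h0 | h0
    · rw [h0, natDegree_zero]; omega
    · exact (natDegree_lt_iff_degree_lt h0).2 (mem_degreeLT.1 (Submodule.add_mem _ hP hQ))
  refine ⟨fun i => (P + Q).coeff i / 2, fun v => ?_⟩
  set u : ℂ := α + 2 * Real.pi * v * Complex.I with hu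
  set w : ℂ := α - 2 * Real.pi * v * Complex.I with hw
  have hu0 : u ≠ 0 := fun h0 => by
    have := congrArg Complex.re h0
    simp [hu] at this
    exact hα.ne' this
  have hw0 : w ≠ 0 := fun h0 => by
    have := congrArg Complex.re h0
    simp [hw] at this
    exact hα.ne' this
  have hrel : 2 * α * (u⁻¹ * w⁻¹) = u⁻¹ + w⁻¹ := by
    field_simp
    rw [hu, hw]; ring
  have e1 := h u⁻¹ w⁻¹ hrel
  have e2 := h w⁻¹ u⁻¹ (by rw [mul_comm w⁻¹, hrel, add_comm])
  have hsym : (symbol α k v : ℂ) = u⁻¹ ^ k * w⁻¹ ^ k := by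
    rw [← mul_pow, ← mul_inv, inv_pow, symbol]
    push_cast
    congr 2
    rw [hu, hw]
    linear_combination ((2 * Real.pi * v) ^ 2 : ℂ) * Complex.I_sq
  have e3 : (symbol α k v : ℂ) =
      (u⁻¹ * aeval u⁻¹ (P + Q) + w⁻¹ * aeval w⁻¹ (P + Q)) / 2 := by
    rw [hsym, map_add, map_add]
    linear_combination (e1 + e2) / 2
  rw [e3, aeval_eq_sum_range' hdeg, aeval_eq_sum_range' hdeg, Finset.mul_sum, Finset.mul_sum,
    ← Finset.sum_add_distrib, Finset.sum_div]
  refine Finset.sum_congr rfl fun i _ => ?_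
  simp only [Complex.real_smul]
  push_cast
  ring

lemma integrableOn_sum_pow_mul_cexp (k : ℕ) (c : ℕ → ℝ) {r : ℂ} (hr : 0 < r.re) :
    IntegrableOn (fun x : ℝ => ((∑ i ∈ Finset.range k, c i * x ^ i : ℝ) : ℂ) *
      Complex.exp (-(r * x))) (Set.Ioi 0) := by
  have : (fun x : ℝ => ((∑ i ∈ Finset.range k, c i * x ^ i : ℝ) : ℂ) * Complex.exp (-(r * x))) =
      fun x : ℝ => ∑ i ∈ Finset.range k, (c i : ℂ) * ((x : ℂ) ^ i * Complex.exp (-(r * x))) := by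
    ext x
    push_cast
    rw [Finset.sum_mul]
    simp only [mul_assoc]
  rw [this]
  exact integrable_finsetSum _ fun i _ => (integrableOn_pow_mul_cexp i hr).const_mul _

lemma integral_sum_pow_mul_cexp (k : ℕ) (c : ℕ → ℝ) {r : ℂ} (hr : 0 < r.re) :
    ∫ x in Set.Ioi (0 : ℝ), ((∑ i ∈ Finset.range k, c i * x ^ i : ℝ) : ℂ) *
      Complex.exp (-(r * x)) =
      ∑ i ∈ Finset.range k, (c i : ℂ) * (i.factorial * r⁻¹ ^ (i + 1)) := by
  simp_rw [← integral_pow_mul_cexp _ hr, ← integral_const_mul]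
  rw [← integral_finsetSum _ fun i _ => (integrableOn_pow_mul_cexp i hr).const_mul _]
  congr 1
  ext x
  push_cast
  rw [Finset.sum_mul]
  simp only [mul_assoc]

lemma integrableOn_Iic_of_comp_neg {f : ℝ → ℂ}
    (h : IntegrableOn (fun x => f (-x)) (Set.Ioi 0)) :
    IntegrableOn f (Set.Iic 0) := by
  rw [← Measure.map_neg_eq_self (volume : Measure ℝ)]
  let m : MeasurableEmbedding fun x : ℝ => -x := (Homeomorph.neg ℝ).measurableEmbedding
  rw [m.integrableOn_map_iff]
  simp_rw [Function.comp_def, Set.neg_preimage, Set.neg_Iic, neg_zero]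
  exact Iff.mpr integrableOn_Ici_iff_integrableOn_Ioi h

/-- The symbol is the Fourier transform of an even exponential polynomial. -/
lemma exists_fourier_evenExpPoly {α : ℝ} (hα : 0 < α) {k : ℕ} (hk : 1 ≤ k) :
    ∃ p ∈ degreeLT ℝ k, Integrable (fun x => (evenExpPoly α p x : ℂ)) ∧
      𝓕 (fun x => (evenExpPoly α p x : ℂ)) = fun v => (symbol α k v : ℂ) := by
  obtain ⟨c, hc⟩ := symbol_eq_sum hα hk
  set e : ℕ → ℝ := fun i => c i / i.factorial with he
  refine ⟨∑ i ∈ Finset.range k, C (e i) * X ^ i, Submodule.sum_mem _ fun i hi => ?_, ?_⟩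
  · refine mem_degreeLT.2 ((degree_C_mul_X_pow_le _ _).trans_lt ?_)
    exact_mod_cast Finset.mem_range.1 hi
  set p : ℝ[X] := ∑ i ∈ Finset.range k, C (e i) * X ^ i with hp
  have hpe (x : ℝ) : p.eval x = ∑ i ∈ Finset.range k, e i * x ^ i := by
    simp [hp, eval_finsetSum]
  have hright (v : ℝ) : ∀ x ∈ Set.Ioi (0 : ℝ),
      Complex.exp ((-2 * Real.pi * x * v : ℝ) * Complex.I) • (evenExpPoly α p x : ℂ) =
      ((∑ i ∈ Finset.range k, e i * x ^ i : ℝ) : ℂ) *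
        Complex.exp (-((α + 2 * Real.pi * v * Complex.I) * x)) := fun x hx => by
    rw [evenExpPoly, abs_of_pos hx, hpe, smul_eq_mul,
      Complex.ofReal_mul (∑ i ∈ Finset.range k, e i * x ^ i), mul_left_comm, Complex.ofReal_exp,
      ← Complex.exp_add]
    push_cast
    congr 2
    ring
  have hre (v : ℝ) : 0 < (α + 2 * Real.pi * v * Complex.I : ℂ).re := by simpa using hα
  have hon (v : ℝ) : IntegrableOn (fun x : ℝ => Complex.exp ((-2 * Real.pi * x * v : ℝ) *
      Complex.I) • (evenExpPoly α p x : ℂ)) (Set.Ioi 0) :=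
    (integrableOn_sum_pow_mul_cexp k e (hre v)).congr_fun (fun x hx => (hright v x hx).symm)
      measurableSet_Ioi
  have hneg (v x : ℝ) : Complex.exp ((-2 * Real.pi * -x * v : ℝ) * Complex.I) •
      (evenExpPoly α p (-x) : ℂ) = Complex.exp ((-2 * Real.pi * x * -v : ℝ) * Complex.I) •
      (evenExpPoly α p x : ℂ) := by
    rw [evenExpPoly_neg]
    congr 4
    ring
  have hon' (v : ℝ) : IntegrableOn (fun x : ℝ => Complex.exp ((-2 * Real.pi * x * v : ℝ) *
      Complex.I) • (evenExpPoly α p x : ℂ)) (Set.Iic 0) := by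
    refine integrableOn_Iic_of_comp_neg ?_
    simp only [hneg]
    exact hon (-v)
  refine ⟨?_, ?_⟩
  · have := (hon' 0).union (hon 0)
    rw [Set.Iic_union_Ioi, integrableOn_univ] at this
    simpa using this
  · ext v
    rw [Real.fourier_real_eq_integral_exp_smul,
      ← intervalIntegral.integral_Iic_add_Ioi (hon' v) (hon v)]
    have hl := integral_comp_neg_Ioi 0 (fun x : ℝ => Complex.exp ((-2 * Real.pi * x * v : ℝ) *
      Complex.I) • (evenExpPoly α p x : ℂ))
    rw [neg_zero] at hl
    rw [← hl]
    simp only [hneg]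
    rw [setIntegral_congr_fun measurableSet_Ioi (hright v),
      setIntegral_congr_fun measurableSet_Ioi (hright (-v)),
      integral_sum_pow_mul_cexp k e (hre v), integral_sum_pow_mul_cexp k e (hre (-v)), hc,
      ← Finset.sum_add_distrib]
    refine Finset.sum_congr rfl fun i _ => ?_
    have : (i.factorial : ℂ) ≠ 0 := by exact_mod_cast i.factorial_ne_zero
    simp only [he]
    push_cast
    rw [mul_neg, neg_mul, ← sub_eq_add_neg]
    field_simp
    ring

lemma symbol_pos {α : ℝ} (hα : 0 < α) (k : ℕ) (v : ℝ) : 0 < symbol α k v := by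
  unfold symbol
  positivity

lemma continuous_symbol {α : ℝ} (hα : 0 < α) (k : ℕ) : Continuous (symbol α k) := by
  unfold symbol
  exact Continuous.inv₀ (by fun_prop) fun v => by positivity

lemma symbol_neg (α : ℝ) (k : ℕ) (v : ℝ) : symbol α k (-v) = symbol α k v := by
  simp [symbol]

lemma exists_abs_pow_mul_symbol_le {α : ℝ} (hα : 0 < α) {k : ℕ} (hk : 1 ≤ k) :
    ∃ K, 0 ≤ K ∧ ∀ n ≤ 2 * k - 2, ∀ v : ℝ, |v| ^ n * symbol α k v ≤ K * (1 + v ^ 2)⁻¹ := by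
  obtain ⟨k, rfl⟩ := Nat.exists_eq_add_of_le' hk
  set c := min 1 (α ^ 2) with hc
  have hc0 : 0 < c := lt_min one_pos (by positivity)
  refine ⟨(c ^ (k + 1))⁻¹, by positivity, fun n hn v => ?_⟩
  have h1 : c * (1 + v ^ 2) ≤ (2 * Real.pi * v) ^ 2 + α ^ 2 := by
    have hpi : (1 : ℝ) ≤ (2 * Real.pi) ^ 2 := by nlinarith [Real.pi_gt_three]
    have := min_le_left 1 (α ^ 2)
    have := min_le_right 1 (α ^ 2)
    rw [mul_pow]
    nlinarith [mul_nonneg (sub_nonneg.2 hpi) (sq_nonneg v),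
      mul_nonneg (sub_nonneg.2 (min_le_left 1 (α ^ 2))) (sq_nonneg v)]
  have h2 : |v| ^ n ≤ (1 + v ^ 2) ^ k := by
    rcases le_total |v| 1 with h | h
    · exact (pow_le_one₀ (abs_nonneg v) h).trans (one_le_pow₀ (by nlinarith [sq_nonneg v]))
    · calc |v| ^ n ≤ |v| ^ (2 * k) := pow_le_pow_right₀ h (by omega)
        _ = (v ^ 2) ^ k := by rw [pow_mul, sq_abs]
        _ ≤ _ := by gcongr; linarith
  calc |v| ^ n * symbol α (k + 1) v
      ≤ (1 + v ^ 2) ^ k * ((c * (1 + v ^ 2)) ^ (k + 1))⁻¹ := by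
        unfold symbol
        gcongr
    _ = _ := by
        have : (1 + v ^ 2) ≠ 0 := by positivity
        rw [mul_pow]
        field_simp
        ring

lemma exists_symbol_le {α : ℝ} (hα : 0 < α) {k : ℕ} (hk : 1 ≤ k) :
    ∃ K, 0 ≤ K ∧ ∀ v : ℝ, symbol α k v ≤ K * (1 + v ^ 2)⁻¹ := by
  obtain ⟨K, hK, h⟩ := exists_abs_pow_mul_symbol_le hα hk
  exact ⟨K, hK, fun v => by simpa using h 0 (Nat.zero_le _) v⟩

lemma integrable_abs_pow_mul_symbol {α : ℝ} (hα : 0 < α) {k : ℕ} (hk : 1 ≤ k) {n : ℕ}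
    (hn : n ≤ 2 * k - 2) : Integrable fun v => |v| ^ n * symbol α k v := by
  obtain ⟨K, -, h⟩ := exists_abs_pow_mul_symbol_le hα hk
  refine (integrable_inv_one_add_sq.const_mul K).mono'
    ((continuous_abs.pow n).mul (continuous_symbol hα k)).aestronglyMeasurable
    (Eventually.of_forall fun v => ?_)
  rw [Real.norm_of_nonneg (mul_nonneg (by positivity) (symbol_pos hα k v).le)]
  exact h n hn v

lemma integrable_symbol {α : ℝ} (hα : 0 < α) {k : ℕ} (hk : 1 ≤ k) : Integrable (symbol α k) := by
  simpa using integrable_abs_pow_mul_symbol hα hk (Nat.zero_le _)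

lemma summable_symbol_add_int {α : ℝ} (hα : 0 < α) {k : ℕ} (hk : 1 ≤ k) (v : ℝ) :
    Summable fun n : ℤ => symbol α k (v + n) := by
  obtain ⟨K, hK, h⟩ := exists_symbol_le hα hk
  have hs : Summable fun n : ℤ => (1 + (n : ℝ) ^ 2)⁻¹ := by
    refine Summable.of_norm_bounded_eventually
      (Real.summable_one_div_int_pow (p := 2).2 one_lt_two) ?_
    filter_upwards [(Set.finite_singleton (0 : ℤ)).compl_mem_cofinite] with n hn
    have hn0 : (n : ℝ) ≠ 0 := by exact_mod_cast hn
    rw [Real.norm_of_nonneg (by positivity), one_div]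
    gcongr
    linarith
  refine Summable.of_nonneg_of_le (fun n => (symbol_pos hα k _).le) (fun n => (h _).trans ?_)
    (hs.mul_left (K * (2 * (1 + v ^ 2))))
  rw [mul_assoc]
  gcongr
  rw [inv_le_comm₀ (by positivity) (by positivity), mul_inv, inv_inv, inv_mul_le_iff₀ (by positivity)]
  nlinarith [sq_nonneg (v + (v + n)), mul_nonneg (sq_nonneg v) (sq_nonneg (v + n))]

/-- The periodization `v ↦ Σₙ ((2π(v+n))² + α²)^{-k}`. -/
noncomputable def symbolSum (α : ℝ) (k : ℕ) (v : ℝ) : ℝ := ∑' n : ℤ, symbol α k (v + n)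

lemma symbolSum_pos {α : ℝ} (hα : 0 < α) {k : ℕ} (hk : 1 ≤ k) (v : ℝ) : 0 < symbolSum α k v :=
  (summable_symbol_add_int hα hk v).tsum_pos (fun _ => (symbol_pos hα k _).le) 0
    (symbol_pos hα k _)

lemma symbolSum_add_one (α : ℝ) (k : ℕ) (v : ℝ) :
    symbolSum α k (v + 1) = symbolSum α k v := by
  unfold symbolSum
  rw [← (Equiv.addRight (1 : ℤ)).tsum_eq (fun n : ℤ => symbol α k (v + n))]
  refine tsum_congr fun n => ?_
  simp only [Equiv.coe_addRight]
  push_cast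
  congr 1
  ring

lemma iteratedDeriv_const_mul_cexp (a c : ℂ) (m : ℕ) :
    iteratedDeriv m (fun v : ℝ => a * Complex.exp (c * v)) =
      fun v : ℝ => a * c ^ m * Complex.exp (c * v) := by
  induction m with
  | zero => simp
  | succ m ih =>
    rw [iteratedDeriv_succ, ih]
    ext v
    have h : HasDerivAt (fun v : ℝ => a * c ^ m * Complex.exp (c * v))
        (a * c ^ m * (Complex.exp (c * v) * (c * 1))) v :=
      ((Complex.ofRealCLM.hasDerivAt (x := v)).const_mul c).cexp.const_mul _
    rw [h.deriv]
    ring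

section

variable {α : ℝ} {k : ℕ} {p : ℝ[X]}

lemma fourier_symbol (hα : 0 < α) (hk : 1 ≤ k)
    (hInt : Integrable (fun x => (evenExpPoly α p x : ℂ)))
    (hF : 𝓕 (fun x => (evenExpPoly α p x : ℂ)) = fun v => (symbol α k v : ℂ)) :
    𝓕 (fun v => (symbol α k v : ℂ)) = fun x => (evenExpPoly α p x : ℂ) := by
  have hc : Continuous fun x => (evenExpPoly α p x : ℂ) :=
    Complex.continuous_ofReal.comp (continuous_evenExpPoly α p)
  have h := hc.fourierInv_fourier_eq hInt (by rw [hF]; exact (integrable_symbol hα hk).ofReal)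
  rw [hF, Real.fourierInv_eq_fourier_comp_neg] at h
  simpa only [symbol_neg] using h

lemma contDiff_evenExpPoly (hα : 0 < α) (hk : 1 ≤ k)
    (hG : 𝓕 (fun v => (symbol α k v : ℂ)) = fun x => (evenExpPoly α p x : ℂ)) :
    ContDiff ℝ (2 * k - 2 : ℕ) (evenExpPoly α p) := by
  have h : ContDiff ℝ ((2 * k - 2 : ℕ) : ℕ∞) (𝓕 (fun v => (symbol α k v : ℂ))) := by
    refine Real.contDiff_fourier fun n hn => ?_
    have := integrable_abs_pow_mul_symbol hα hk (n := n) (by exact_mod_cast hn)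
    refine this.congr (Eventually.of_forall fun v => ?_)
    simp [abs_of_pos (symbol_pos hα k v)]
  rw [hG] at h
  exact Complex.reCLM.contDiff.comp h

lemma evenExpPoly_eq_integral
    (hG : 𝓕 (fun v => (symbol α k v : ℂ)) = fun x => (evenExpPoly α p x : ℂ)) (x : ℝ) :
    ∫ v : ℝ, (symbol α k v : ℂ) * Complex.exp (2 * Real.pi * Complex.I * x * v) =
      evenExpPoly α p x := by
  rw [← evenExpPoly_neg, ← congrFun hG (-x), Real.fourier_real_eq_integral_exp_smul]
  congr 1
  ext v
  rw [smul_eq_mul, mul_comm]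
  push_cast
  congr 2
  ring

lemma hasSum_symbolSum (hα : 0 < α) (hk : 1 ≤ k)
    (hG : 𝓕 (fun v => (symbol α k v : ℂ)) = fun x => (evenExpPoly α p x : ℂ)) (v : ℝ) :
    HasSum (fun n : ℤ => (evenExpPoly α p n : ℂ) * Complex.exp (2 * Real.pi * Complex.I * n * v))
      (symbolSum α k v) := by
  have hs : Summable fun n : ℤ => evenExpPoly α p n := by
    have := summable_mul_evenExpPoly hα p (d := fun _ => 1) (K := 1) (N := 0) (by simp) 0
    simpa [evenExpPoly_neg] using this
  have hO : (fun v => (symbol α k v : ℂ)) =O[cocompact ℝ] fun x : ℝ => |x| ^ (-2 : ℝ) := by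
    obtain ⟨K, hK, h⟩ := exists_symbol_le hα hk
    refine Asymptotics.IsBigO.of_bound K ?_
    filter_upwards [(isCompact_singleton (x := (0 : ℝ))).compl_mem_cocompact] with v hv
    have hv0 : v ≠ 0 := hv
    rw [Complex.norm_real, Real.norm_of_nonneg (symbol_pos hα k v).le,
      Real.norm_of_nonneg (by positivity), Real.rpow_neg (abs_nonneg v)]
    refine (h v).trans ?_
    norm_num
    gcongr
    linarith
  have hs' : Summable fun n : ℤ => 𝓕 (fun v => (symbol α k v : ℂ)) n := by
    simp only [hG]
    exact_mod_cast hs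
  have hP := Real.tsum_eq_tsum_fourier_of_rpow_decay_of_summable
    (Complex.continuous_ofReal.comp (continuous_symbol hα k)) one_lt_two hO
    hs' v
  simp only [Function.comp_def] at hP
  rw [← Complex.ofReal_tsum] at hP
  rw [symbolSum, hP]
  have hterm : (fun n : ℤ => 𝓕 (fun v => (symbol α k v : ℂ)) n * fourier n (v : UnitAddCircle)) =
      fun n : ℤ => (evenExpPoly α p n : ℂ) * Complex.exp (2 * Real.pi * Complex.I * n * v) := by
    ext n
    rw [hG, fourier_coe_apply]
    simp
  rw [hterm]
  refine (Summable.of_norm ?_).hasSum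
  refine hs.norm.congr fun n => ?_
  rw [norm_mul, Complex.norm_real, Complex.norm_exp]
  simp

lemma contDiff_symbolSum (hα : 0 < α) (hk : 1 ≤ k)
    (hG : 𝓕 (fun v => (symbol α k v : ℂ)) = fun x => (evenExpPoly α p x : ℂ)) (N : ℕ∞) :
    ContDiff ℝ N fun v => (symbolSum α k v : ℂ) := by
  have heq : (fun v => (symbolSum α k v : ℂ)) = fun v : ℝ => ∑' n : ℤ,
      (evenExpPoly α p n : ℂ) * Complex.exp (2 * Real.pi * Complex.I * n * v) :=
    funext fun v => (hasSum_symbolSum hα hk hG v).tsum_eq.symm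
  rw [heq]
  refine contDiff_tsum (v := fun m (n : ℤ) => |(2 * Real.pi * |(n : ℝ)|) ^ m * evenExpPoly α p n|)
    (fun n => ?_) (fun m _ => ?_) fun m n v _ => ?_
  · exact contDiff_const.mul (contDiff_const.mul Complex.ofRealCLM.contDiff).cexp
  · have := summable_mul_evenExpPoly hα p (d := fun n : ℤ => (2 * Real.pi * |(n : ℝ)|) ^ m)
      (K := (2 * Real.pi) ^ m) (N := m) (fun n => ?_) 0
    · simpa [evenExpPoly_neg] using this.abs
    · rw [abs_of_nonneg (by positivity), mul_pow]
      gcongr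
      linarith
  · rw [norm_iteratedFDeriv_eq_norm_iteratedDeriv, iteratedDeriv_const_mul_cexp]
    rw [norm_mul, norm_mul, norm_pow, Complex.norm_real, Complex.norm_exp, abs_mul, mul_comm (|_|)]
    simp [abs_of_pos Real.pi_pos]

end

/-- The Fourier coefficients of a function of period one. -/
noncomputable def unitFourierCoeff (f : ℝ → ℂ) (n : ℤ) : ℂ :=
  ∫ v in (0 : ℝ)..1, Complex.exp (-(2 * Real.pi * Complex.I * n) * v) * f v

lemma unitFourierCoeff_deriv {f : ℝ → ℂ} (hf : ContDiff ℝ 1 f) (hper : Function.Periodic f 1)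
    (n : ℤ) :
    unitFourierCoeff (deriv f) n = 2 * Real.pi * Complex.I * n * unitFourierCoeff f n := by
  set c : ℂ := -(2 * Real.pi * Complex.I * n) with hc
  have hexp (v : ℝ) : HasDerivAt (fun v : ℝ => Complex.exp (c * v))
      (Complex.exp (c * v) * (c * 1)) v :=
    ((Complex.ofRealCLM.hasDerivAt (x := v)).const_mul c).cexp
  have h := intervalIntegral.integral_mul_deriv_eq_deriv_mul (a := 0) (b := 1)
    (fun v _ => hexp v) (fun v _ => (hf.differentiable one_ne_zero v).hasDerivAt)
    (Continuous.intervalIntegrable (by fun_prop) _ _)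
    ((hf.continuous_deriv le_rfl).intervalIntegrable _ _)
  have h1 : Complex.exp (c * (1 : ℝ)) = 1 := by
    have := Complex.exp_int_mul_two_pi_mul_I (-n)
    rw [← this, hc]
    push_cast
    congr 1
    ring
  have h2 : f 1 = f 0 := by simpa using hper 0
  rw [h1, h2] at h
  rw [unitFourierCoeff, h, unitFourierCoeff, ← hc,
    show 2 * Real.pi * Complex.I * n = -c by rw [hc, neg_neg],
    ← intervalIntegral.integral_const_mul]
  simp only [Complex.ofReal_zero, mul_zero, Complex.exp_zero, sub_self, zero_sub,
    ← intervalIntegral.integral_neg]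
  refine intervalIntegral.integral_congr fun v _ => ?_
  ring

lemma periodic_deriv {f : ℝ → ℂ} (hper : Function.Periodic f 1) :
    Function.Periodic (deriv f) 1 := fun x => by
  rw [← deriv_comp_add_const, funext hper]

lemma contDiff_periodic_iteratedDeriv {f : ℝ → ℂ} (hf : ∀ N : ℕ, ContDiff ℝ N f)
    (hper : Function.Periodic f 1) (n : ℤ) (m : ℕ) :
    (∀ N : ℕ, ContDiff ℝ N (iteratedDeriv m f)) ∧ Function.Periodic (iteratedDeriv m f) 1 ∧
      unitFourierCoeff (iteratedDeriv m f) n =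
        (2 * Real.pi * Complex.I * n) ^ m * unitFourierCoeff f n := by
  induction m with
  | zero => simpa using ⟨hf, hper⟩
  | succ m ih =>
    obtain ⟨h1, h2, h3⟩ := ih
    rw [iteratedDeriv_succ]
    refine ⟨fun N => ?_, periodic_deriv h2, ?_⟩
    · have h : ContDiff ℝ ((N : WithTop ℕ∞) + 1) (iteratedDeriv m f) := by
        exact_mod_cast h1 (N + 1)
      exact (contDiff_succ_iff_deriv.1 h).2.2
    · rw [unitFourierCoeff_deriv (by exact_mod_cast h1 1) h2, h3]
      ring

lemma exists_norm_unitFourierCoeff_le {f : ℝ → ℂ} (hf : Continuous f) :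
    ∃ M, ∀ n, ‖unitFourierCoeff f n‖ ≤ M := by
  obtain ⟨M, hM⟩ := (isCompact_Icc (a := (0 : ℝ)) (b := 1)).exists_bound_of_continuousOn
    hf.continuousOn
  refine ⟨M * |1 - 0|, fun n => intervalIntegral.norm_integral_le_of_norm_le_const fun v hv => ?_⟩
  rw [Set.uIoc_of_le zero_le_one] at hv
  rw [norm_mul, Complex.norm_exp]
  simpa using hM v ⟨hv.1.le, hv.2⟩

lemma summable_pow_mul_norm_unitFourierCoeff {f : ℝ → ℂ} (hf : ∀ N : ℕ, ContDiff ℝ N f)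
    (hper : Function.Periodic f 1) (N : ℕ) :
    Summable fun n : ℤ => (1 + |(n : ℝ)|) ^ N * ‖unitFourierCoeff f n‖ := by
  obtain ⟨M, hM⟩ := exists_norm_unitFourierCoeff_le
    ((contDiff_periodic_iteratedDeriv hf hper 0 (N + 2)).1 0).continuous
  refine Summable.of_norm_bounded_eventually
    ((Real.summable_one_div_int_pow (p := 2).2 one_lt_two).mul_left M) ?_
  filter_upwards [(Set.finite_singleton (0 : ℤ)).compl_mem_cofinite] with n hn
  have hn0 : n ≠ 0 := hn
  have hn1 : (1 : ℝ) ≤ |(n : ℝ)| := by exact_mod_cast Int.one_le_abs hn0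
  have h := hM n
  rw [(contDiff_periodic_iteratedDeriv hf hper n (N + 2)).2.2, norm_mul, norm_pow] at h
  have hnorm : ‖(2 * Real.pi * Complex.I * n : ℂ)‖ = 2 * Real.pi * |(n : ℝ)| := by
    simp [abs_of_pos Real.pi_pos]
  rw [hnorm] at h
  have hle : 1 + |(n : ℝ)| ≤ 2 * Real.pi * |(n : ℝ)| := by nlinarith [Real.pi_gt_three]
  have hle' : |(n : ℝ)| ≤ 2 * Real.pi * |(n : ℝ)| := by nlinarith [Real.pi_gt_three]
  rw [Real.norm_of_nonneg (by positivity), ← sq_abs, mul_one_div, le_div_iff₀ (by positivity)]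
  calc _ = (1 + |(n : ℝ)|) ^ N * |(n : ℝ)| ^ 2 * ‖unitFourierCoeff f n‖ := by ring
    _ ≤ (2 * Real.pi * |(n : ℝ)|) ^ N * (2 * Real.pi * |(n : ℝ)|) ^ 2 *
        ‖unitFourierCoeff f n‖ := by gcongr
    _ ≤ M := by rwa [← pow_add]

lemma hasSum_unitFourierCoeff {f : ℝ → ℂ} (hf : ∀ N : ℕ, ContDiff ℝ N f)
    (hper : Function.Periodic f 1) (v : ℝ) :
    HasSum (fun n : ℤ => unitFourierCoeff f n * Complex.exp (2 * Real.pi * Complex.I * n * v))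
      (f v) := by
  let F : C(UnitAddCircle, ℂ) := ⟨hper.lift,
    continuous_coinduced_dom.2 (hf 0).continuous⟩
  have hF (x : ℝ) : F (x : UnitAddCircle) = f x := hper.lift_coe x
  have hcoeff : fourierCoeff F = unitFourierCoeff f := by
    ext n
    rw [fourierCoeff_eq_intervalIntegral _ n 0, unitFourierCoeff, zero_add, div_one, one_smul]
    refine intervalIntegral.integral_congr fun x _ => ?_
    simp only [hF, smul_eq_mul]
    rw [fourier_coe_apply]
    push_cast
    rw [div_one]
    congr 2
    ring
  have hs : Summable (fourierCoeff F) := by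
    rw [hcoeff]
    exact Summable.of_norm (by simpa using summable_pow_mul_norm_unitFourierCoeff hf hper 0)
  have h := has_pointwise_sum_fourier_series_of_summable hs (v : UnitAddCircle)
  rw [hF, hcoeff] at h
  refine h.congr_fun fun n => ?_
  rw [smul_eq_mul, fourier_coe_apply]
  simp

lemma S_two_pi_mul (α : ℝ) (k : ℕ) (v : ℝ) : S α k (2 * Real.pi * v) = symbolSum α k v := by
  unfold S symbolSum
  rw [← (Equiv.neg ℤ).tsum_eq (fun n : ℤ => symbol α k (v + n))]
  refine tsum_congr fun n => ?_
  simp only [symbol, Equiv.neg_apply]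
  push_cast
  congr 4
  ring

lemma Lk_eq_integral (α : ℝ) (k : ℕ) (x : ℝ) :
    Lk α k x = (∫ v : ℝ, (symbol α k v : ℂ) * ((symbolSum α k v : ℂ)⁻¹ *
      Complex.exp (2 * Real.pi * Complex.I * x * v))).re := by
  have h2pi : (0 : ℝ) < 2 * Real.pi := by positivity
  have hsub := Measure.integral_comp_mul_left
    (fun ξ : ℝ => (Lhat α k ξ : ℂ) * Complex.exp (Complex.I * x * ξ)) (2 * Real.pi)
  rw [abs_of_pos (inv_pos.2 h2pi)] at hsub
  have hInt : ∫ ξ : ℝ, (Lhat α k ξ : ℂ) * Complex.exp (Complex.I * x * ξ) =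
      (2 * Real.pi : ℝ) • ∫ v : ℝ, (Lhat α k (2 * Real.pi * v) : ℂ) *
        Complex.exp (Complex.I * x * (2 * Real.pi * v : ℝ)) := by
    rw [hsub, smul_smul, mul_inv_cancel₀ h2pi.ne', one_smul]
  have hsqrt : (Real.sqrt (2 * Real.pi) : ℂ) * Real.sqrt (2 * Real.pi) = 2 * Real.pi := by
    rw [← Complex.ofReal_mul, Real.mul_self_sqrt h2pi.le]
    push_cast
    rfl
  have hsqrt0 : (Real.sqrt (2 * Real.pi) : ℂ) ≠ 0 := by
    exact_mod_cast (Real.sqrt_pos.2 h2pi).ne'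
  rw [Lk, hInt, ← integral_smul, ← integral_const_mul]
  congr 2
  ext v
  rw [Lhat, S_two_pi_mul, Complex.real_smul, symbol]
  push_cast
  rw [← hsqrt]
  field_simp

/-- The reciprocal of the periodized symbol. -/
noncomputable def symbolSumInv (α : ℝ) (k : ℕ) (v : ℝ) : ℂ := (symbolSum α k v : ℂ)⁻¹

lemma periodic_symbolSumInv (α : ℝ) (k : ℕ) : Function.Periodic (symbolSumInv α k) 1 := fun v => by
  simp [symbolSumInv, symbolSum_add_one]

lemma unitFourierCoeff_one (n : ℤ) :
    unitFourierCoeff (fun _ => 1) n = if n = 0 then 1 else 0 := by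
  split_ifs with h
  · simp [h, unitFourierCoeff]
  · have := unitFourierCoeff_deriv (f := fun _ => 1) contDiff_const (fun _ => rfl) n
    have h0 : unitFourierCoeff (deriv fun _ : ℝ => (1 : ℂ)) n = 0 := by
      simp [unitFourierCoeff]
    rw [h0, eq_comm, mul_eq_zero] at this
    refine this.resolve_left ?_
    simp [h, Real.pi_ne_zero]

section

variable {α : ℝ} {k : ℕ} {p : ℝ[X]}

lemma contDiff_symbolSumInv (hα : 0 < α) (hk : 1 ≤ k)
    (hG : 𝓕 (fun v => (symbol α k v : ℂ)) = fun x => (evenExpPoly α p x : ℂ)) (N : ℕ) :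
    ContDiff ℝ N (symbolSumInv α k) :=
  (contDiff_symbolSum hα hk hG N).inv fun v => by exact_mod_cast (symbolSum_pos hα hk v).ne'

lemma hasSum_Lk (hα : 0 < α) (hk : 1 ≤ k)
    (hG : 𝓕 (fun v => (symbol α k v : ℂ)) = fun x => (evenExpPoly α p x : ℂ)) (x : ℝ) :
    HasSum (fun n : ℤ => (unitFourierCoeff (symbolSumInv α k) n).re * evenExpPoly α p (x + n))
      (Lk α k x) := by
  set a := unitFourierCoeff (symbolSumInv α k) with ha
  have hsm := contDiff_symbolSumInv hα hk hG
  have hper := periodic_symbolSumInv α k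
  let F : ℤ → ℝ → ℂ := fun n v =>
    a n * ((symbol α k v : ℂ) * Complex.exp (2 * Real.pi * Complex.I * (x + n : ℝ) * v))
  have hnorm (n : ℤ) (v : ℝ) : ‖F n v‖ = ‖a n‖ * symbol α k v := by
    simp only [F]
    rw [norm_mul, norm_mul, Complex.norm_real, Real.norm_of_nonneg (symbol_pos hα k v).le,
      Complex.norm_exp]
    simp
  have hcont := continuous_symbol hα k
  have hFint (n : ℤ) : Integrable (F n) :=
    ((integrable_symbol hα hk).const_mul ‖a n‖).mono'
      (by simp only [F]; exact Continuous.aestronglyMeasurable (by fun_prop))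
      (Eventually.of_forall fun v => (hnorm n v).le)
  have hsum : Summable fun n => ∫ v, ‖F n v‖ := by
    simp only [hnorm, integral_const_mul]
    refine Summable.mul_right _ ?_
    simpa using summable_pow_mul_norm_unitFourierCoeff hsm hper 0
  have h := hasSum_integral_of_summable_integral_norm hFint hsum
  have hterm (n : ℤ) : ∫ v, F n v = a n * evenExpPoly α p (x + n) := by
    simp only [F]
    rw [integral_const_mul, evenExpPoly_eq_integral hG]
  have htot (v : ℝ) : ∑' n, F n v = (symbol α k v : ℂ) * ((symbolSum α k v : ℂ)⁻¹ *
      Complex.exp (2 * Real.pi * Complex.I * x * v)) := by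
    have := ((hasSum_unitFourierCoeff hsm hper v).mul_right
      ((symbol α k v : ℂ) * Complex.exp (2 * Real.pi * Complex.I * x * v))).tsum_eq
    rw [symbolSumInv] at this
    rw [mul_left_comm, ← this]
    refine tsum_congr fun n => ?_
    simp only [F]
    rw [← ha, mul_assoc (a n) (Complex.exp _), mul_left_comm (Complex.exp _), ← Complex.exp_add]
    push_cast
    congr 3
    ring
  simp only [hterm, htot] at h
  rw [Lk_eq_integral]
  have hre := Complex.hasSum_re h
  simpa only [Complex.re_mul_ofReal] using hre

/-- The fundamental function interpolates the unit sequence. -/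
lemma Lk_int (hα : 0 < α) (hk : 1 ≤ k)
    (hG : 𝓕 (fun v => (symbol α k v : ℂ)) = fun x => (evenExpPoly α p x : ℂ)) (j : ℤ) :
    Lk α k j = if j = 0 then 1 else 0 := by
  set a := unitFourierCoeff (symbolSumInv α k) with ha
  have hφ : Continuous (symbolSumInv α k) := (contDiff_symbolSumInv hα hk hG 0).continuous
  obtain ⟨M, hM⟩ := (isCompact_Icc (a := (0 : ℝ)) (b := 1)).exists_bound_of_continuousOn
    hφ.continuousOn
  have hs : Summable fun n : ℤ => evenExpPoly α p n := by
    have := summable_mul_evenExpPoly hα p (d := fun _ => 1) (K := 1) (N := 0) (by simp) 0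
    simpa [evenExpPoly_neg] using this
  have h : HasSum (fun n : ℤ => ∫ v in (0 : ℝ)..1,
      (evenExpPoly α p n : ℂ) * Complex.exp (2 * Real.pi * Complex.I * n * v) *
        (Complex.exp (-(2 * Real.pi * Complex.I * (-j : ℤ)) * v) * symbolSumInv α k v))
      (∫ v in (0 : ℝ)..1, Complex.exp (-(2 * Real.pi * Complex.I * (-j : ℤ)) * v) * 1) := by
    refine intervalIntegral.hasSum_integral_of_dominated_convergence
      (fun n _ => ‖evenExpPoly α p n‖ * M) (fun n => ?_) (fun n => ?_) ?_ ?_ ?_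
    · exact Continuous.aestronglyMeasurable (by fun_prop)
    · refine Eventually.of_forall fun v hv => ?_
      rw [Set.uIoc_of_le zero_le_one] at hv
      rw [norm_mul, norm_mul, norm_mul, Complex.norm_real, Complex.norm_exp, Complex.norm_exp]
      have := hM v ⟨hv.1.le, hv.2⟩
      simpa using mul_le_mul_of_nonneg_left this (abs_nonneg _)
    · exact Eventually.of_forall fun v _ => hs.norm.mul_right M
    · exact intervalIntegrable_const
    · refine Eventually.of_forall fun v _ => ?_
      have hσ : (symbolSum α k v : ℂ) ≠ 0 := by exact_mod_cast (symbolSum_pos hα hk v).ne'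
      have := (hasSum_symbolSum hα hk hG v).mul_right
        (Complex.exp (-(2 * Real.pi * Complex.I * (-j : ℤ)) * v) * symbolSumInv α k v)
      have e : Complex.exp (-(2 * Real.pi * Complex.I * (-j : ℤ)) * v) * 1 =
          (symbolSum α k v : ℂ) *
            (Complex.exp (-(2 * Real.pi * Complex.I * (-j : ℤ)) * v) * symbolSumInv α k v) := by
        simp only [symbolSumInv]
        field_simp
      rw [e]
      exact this
  have hone : ∫ v in (0 : ℝ)..1, Complex.exp (-(2 * Real.pi * Complex.I * (-j : ℤ)) * v) * 1 =
      if j = 0 then 1 else 0 := by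
    simpa [unitFourierCoeff] using unitFourierCoeff_one (-j)
  have hterm (n : ℤ) : ∫ v in (0 : ℝ)..1,
      (evenExpPoly α p n : ℂ) * Complex.exp (2 * Real.pi * Complex.I * n * v) *
        (Complex.exp (-(2 * Real.pi * Complex.I * (-j : ℤ)) * v) * symbolSumInv α k v) =
      evenExpPoly α p n * a (-(n + j)) := by
    rw [ha, unitFourierCoeff, ← intervalIntegral.integral_const_mul]
    refine intervalIntegral.integral_congr fun v _ => ?_
    rw [mul_assoc (evenExpPoly α p n : ℂ) (Complex.exp _), ← mul_assoc (Complex.exp _), ← Complex.exp_add]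
    push_cast
    congr 3
    ring
  simp only [hterm, hone] at h
  have hre := Complex.hasSum_re h
  simp only [Complex.re_ofReal_mul] at hre
  let e : ℤ ≃ ℤ := (Equiv.addRight j).trans (Equiv.neg ℤ)
  have hL := e.hasSum_iff.2 (hasSum_Lk hα hk hG (j : ℝ))
  have heq : (fun n : ℤ => (unitFourierCoeff (symbolSumInv α k) n).re *
      evenExpPoly α p ((j : ℝ) + n)) ∘ e = fun n : ℤ => evenExpPoly α p n * (a (-(n + j))).re := by
    ext n
    have : (j : ℝ) + (-(n + j) : ℤ) = -(n : ℝ) := by push_cast; ring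
    simp only [Function.comp, e, Equiv.trans_apply, Equiv.coe_addRight, Equiv.neg_apply]
    rw [this, evenExpPoly_neg, mul_comm]
  rw [heq] at hL
  rw [hL.unique hre]
  split_ifs <;> simp

end

lemma Polynomial.comp_neg_X_mem_degreeLT {k : ℕ} {p : ℝ[X]} (hp : p ∈ degreeLT ℝ k) :
    p.comp (-X) ∈ degreeLT ℝ k := by
  rw [mem_degreeLT] at *
  rcases eq_or_ne p 0 with rfl | h0
  · simp
  · have : (p.comp (-X)).natDegree = p.natDegree := by simp [natDegree_comp]
    refine degree_le_natDegree.trans_lt ?_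
    rwa [this, ← degree_eq_natDegree h0]

section

variable {α : ℝ} {k : ℕ} {p : ℝ[X]} {d : ℤ → ℝ} {K : ℝ} {N : ℕ}

lemma evenExpPoly_of_nonneg (α : ℝ) (p : ℝ[X]) {x : ℝ} (hx : 0 ≤ x) :
    evenExpPoly α p x = expPoly (-α) p x := by
  rw [evenExpPoly, expPoly_apply, abs_of_nonneg hx, neg_mul]

lemma evenExpPoly_of_nonpos (α : ℝ) (p : ℝ[X]) {x : ℝ} (hx : x ≤ 0) :
    evenExpPoly α p x = expPoly α (p.comp (-X)) x := by
  rw [evenExpPoly, expPoly_apply, abs_of_nonpos hx]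
  simp

/-- The contribution of the translates centred to the left of `l`. -/
lemma exists_expPoly_eq_tsum_lt (hα : 0 < α) (hp : p ∈ degreeLT ℝ k)
    (hd : ∀ m, |d m| ≤ K * (1 + |(m : ℝ)|) ^ N) (l : ℤ) :
    ∃ P ∈ degreeLT ℝ k, ∀ x : ℝ,
      HasSum (fun m : ℤ => if m < l then d m * expPoly (-α) p (x - m) else 0)
        (expPoly (-α) P x) := by
  have hs (x : ℝ) : Summable fun m : ℤ => if m < l then d m * expPoly (-α) p (x - m) else 0 := by
    have := summable_polyGrowth_mul hα hd p (R := |x|) (y := fun m => x - m)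
      (B := Real.exp (α * (|x| + 2 * |(l : ℝ)|)))
      (w := fun m => if m < l then Real.exp (-α * (x - m)) else 0)
      (fun m => abs_sub x m) fun m => ?_
    · refine this.congr fun m => ?_
      split_ifs <;> simp [expPoly_apply]
    · split_ifs with h
      · rw [Real.abs_exp, ← Real.exp_add]
        refine Real.exp_le_exp.2 ?_
        have h' : (m : ℝ) < l := by exact_mod_cast h
        have : -(x - m) ≤ |x| + 2 * |(l : ℝ)| - |(m : ℝ)| := by
          have := neg_abs_le x
          have := le_abs_self (l : ℝ)
          have := abs_nonneg (l : ℝ)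
          rcases abs_cases (m : ℝ) with h | h <;> linarith
        nlinarith
      · rw [abs_zero]; positivity
  have hmem (m : ℤ) : (fun x => if m < l then d m * expPoly (-α) p (x - m) else 0) ∈
      (degreeLT ℝ k).map (expPoly (-α)) := by
    split_ifs
    · exact Submodule.smul_mem _ (d m) (expPoly_comp_sub hp m)
    · exact Submodule.zero_mem _
  obtain ⟨P, hP, h⟩ := tsum_mem_expPoly hmem hs
  refine ⟨P, hP, fun x => ?_⟩
  rw [h]
  exact (hs x).hasSum

/-- The contribution of the translates centred to the right of `l`. -/
lemma exists_expPoly_eq_tsum_gt (hα : 0 < α) (hp : p ∈ degreeLT ℝ k)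
    (hd : ∀ m, |d m| ≤ K * (1 + |(m : ℝ)|) ^ N) (l : ℤ) :
    ∃ P ∈ degreeLT ℝ k, ∀ x : ℝ,
      HasSum (fun m : ℤ => if l < m then d m * expPoly α p (x - m) else 0)
        (expPoly α P x) := by
  have hs (x : ℝ) : Summable fun m : ℤ => if l < m then d m * expPoly α p (x - m) else 0 := by
    have := summable_polyGrowth_mul hα hd p (R := |x|) (y := fun m => x - m)
      (B := Real.exp (α * (|x| + 2 * |(l : ℝ)|)))
      (w := fun m => if l < m then Real.exp (α * (x - m)) else 0)
      (fun m => abs_sub x m) fun m => ?_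
    · refine this.congr fun m => ?_
      split_ifs <;> simp [expPoly_apply]
    · split_ifs with h
      · rw [Real.abs_exp, ← Real.exp_add]
        refine Real.exp_le_exp.2 ?_
        have h' : (l : ℝ) < m := by exact_mod_cast h
        have : x - m ≤ |x| + 2 * |(l : ℝ)| - |(m : ℝ)| := by
          have := le_abs_self x
          have := neg_abs_le (l : ℝ)
          have := abs_nonneg (l : ℝ)
          rcases abs_cases (m : ℝ) with h | h <;> linarith
        nlinarith
      · rw [abs_zero]; positivity
  have hmem (m : ℤ) : (fun x => if l < m then d m * expPoly α p (x - m) else 0) ∈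
      (degreeLT ℝ k).map (expPoly α) := by
    split_ifs
    · exact Submodule.smul_mem _ (d m) (expPoly_comp_sub hp m)
    · exact Submodule.zero_mem _
  obtain ⟨P, hP, h⟩ := tsum_mem_expPoly hmem hs
  refine ⟨P, hP, fun x => ?_⟩
  rw [h]
  exact (hs x).hasSum

lemma exists_tsum_evenExpPoly_eq (hα : 0 < α) (hp : p ∈ degreeLT ℝ k)
    (hd : ∀ m, |d m| ≤ K * (1 + |(m : ℝ)|) ^ N) (l : ℤ) :
    ∃ P ∈ degreeLT ℝ k, ∃ Q ∈ degreeLT ℝ k, ∀ x ∈ Set.Ioo (l - 1 : ℝ) (l + 1),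
      ∑' m : ℤ, d m * evenExpPoly α p (x - m) =
        expPoly (-α) P x + expPoly α Q x + d l * evenExpPoly α p (x - l) := by
  obtain ⟨P, hP, hPs⟩ := exists_expPoly_eq_tsum_lt hα hp hd l
  obtain ⟨Q, hQ, hQs⟩ := exists_expPoly_eq_tsum_gt hα (comp_neg_X_mem_degreeLT hp) hd l
  refine ⟨P, hP, Q, hQ, fun x hx => ?_⟩
  have h := ((hPs x).add (hQs x)).add (hasSum_ite_eq l (d l * evenExpPoly α p (x - l)))
  rw [← h.tsum_eq]
  refine tsum_congr fun m => ?_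
  rcases lt_trichotomy m l with hm | rfl | hm
  · have : (m : ℝ) + 1 ≤ l := by exact_mod_cast hm
    simp [hm, hm.not_gt, hm.ne, evenExpPoly_of_nonneg α p (x := x - m) (by linarith [hx.1])]
  · simp
  · have : (l : ℝ) + 1 ≤ m := by exact_mod_cast hm
    simp [hm, hm.not_gt, hm.ne', evenExpPoly_of_nonpos α p (x := x - m) (by linarith [hx.2])]

/-- Superpositions of translates of the Green's function are hyperbolic cardinal splines. -/
lemma isHyperbolicSpline_tsum (hα : 0 < α) (hp : p ∈ degreeLT ℝ k)
    (hcd : ContDiff ℝ (2 * k - 2 : ℕ) (evenExpPoly α p))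
    (hd : ∀ m, |d m| ≤ K * (1 + |(m : ℝ)|) ^ N) :
    IsHyperbolicSpline α k fun x => ∑' m : ℤ, d m * evenExpPoly α p (x - m) := by
  refine ⟨contDiff_iff_contDiffAt.2 fun x₀ => ?_, fun x₀ hx₀ => ?_⟩
  · obtain ⟨P, -, Q, -, h⟩ := exists_tsum_evenExpPoly_eq hα hp hd ⌊x₀⌋
    refine ContDiffAt.congr_of_eventuallyEq (ContDiff.contDiffAt
      (((contDiff_expPoly (-α) P).add (contDiff_expPoly α Q)).add (contDiff_const.mul
        (hcd.comp (contDiff_id.sub contDiff_const)))))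
      (eventually_of_mem (Ioo_mem_nhds ?_ (Int.lt_floor_add_one x₀)) h)
    linarith [Int.floor_le x₀]
  · obtain ⟨P, hP, Q, hQ, h⟩ := exists_tsum_evenExpPoly_eq hα hp hd ⌊x₀⌋
    obtain ⟨R, hR, hRe⟩ := expPoly_comp_sub (c := -α) hp ⌊x₀⌋
    have hlt : (⌊x₀⌋ : ℝ) < x₀ := lt_of_le_of_ne (Int.floor_le x₀) (hx₀ _).symm
    have hP' : P + d ⌊x₀⌋ • R ∈ degreeLT ℝ k := add_mem hP (Submodule.smul_mem _ _ hR)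
    set P' := P + d ⌊x₀⌋ • R with hP'def
    have hloc : (fun x => ∑' m : ℤ, d m * evenExpPoly α p (x - m)) =ᶠ[𝓝 x₀]
        expPoly (-α) P' + expPoly α Q := by
      filter_upwards [Ioo_mem_nhds hlt (Int.lt_floor_add_one x₀)] with x hx
      rw [h x ⟨by linarith [hx.1], hx.2⟩, evenExpPoly_of_nonneg α p (by linarith [hx.1]),
        ← congrFun hRe x, hP'def, map_add, map_smul]
      simp only [Pi.add_apply, Pi.smul_apply, smul_eq_mul]
      ring
    have hsmooth (n : ℕ) : ContDiff ℝ n (expPoly (-α) P' + expPoly α Q) :=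
      (contDiff_expPoly (-α) P').add (contDiff_expPoly α Q)
    refine ⟨fun m _ => ?_, ?_⟩
    · refine DifferentiableAt.congr_of_eventuallyEq ?_ (hloc.iteratedDeriv m)
      exact ((hsmooth (m + 1)).differentiable_iteratedDeriv m
        (by exact_mod_cast m.lt_succ_self)) x₀
    · have hα' : (-α) ^ 2 = α ^ 2 := neg_sq α
      have h1 := sum_iteratedDeriv_expPoly_eq_zero hα' hP' x₀
      have h2 := sum_iteratedDeriv_expPoly_eq_zero (rfl : α ^ 2 = α ^ 2) hQ x₀
      rw [← add_zero (0 : ℝ)]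
      nth_rewrite 1 [← h1]
      rw [← h2, ← Finset.sum_add_distrib]
      refine Finset.sum_congr rfl fun m _ => ?_
      rw [hloc.iteratedDeriv_eq, iteratedDeriv_add (contDiff_expPoly _ _).contDiffAt
        (contDiff_expPoly _ _).contDiffAt, mul_add]

end

/-- Discrete convolution of a polynomially bounded sequence with a rapidly decaying one, paired
with a third rapidly decaying sequence, may be summed in either order. -/
lemma tsum_mul_convolution_eq {b A γ : ℤ → ℝ} {C : ℝ} {N : ℕ} (hC : 0 ≤ C)
    (hb : ∀ j, |b j| ≤ C * (1 + |(j : ℝ)|) ^ N)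
    (hA : Summable fun n : ℤ => (1 + |(n : ℝ)|) ^ N * |A n|)
    (hγ : Summable fun m : ℤ => (1 + |(m : ℝ)|) ^ N * |γ m|) :
    ∑' j, b j * ∑' n, A n * γ (j - n) = ∑' m, (∑' n, b (m + n) * A n) * γ m := by
  have hbound (m n : ℤ) : |b (m + n)| ≤ C * (1 + |(m : ℝ)|) ^ N * (1 + |(n : ℝ)|) ^ N := by
    refine (hb _).trans ?_
    rw [mul_assoc, ← mul_pow]
    push_cast
    gcongr
    exact one_add_abs_le_mul _ _
  have hu : Summable fun q : ℤ × ℤ => b (q.1 + q.2) * A q.2 * γ q.1 := by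
    have h := (hγ.mul_of_nonneg hA (fun m => by positivity) fun n => by positivity).mul_left C
    refine Summable.of_norm_bounded h fun q => ?_
    rw [Real.norm_eq_abs, abs_mul, abs_mul]
    calc |b (q.1 + q.2)| * |A q.2| * |γ q.1|
        ≤ C * (1 + |(q.1 : ℝ)|) ^ N * (1 + |(q.2 : ℝ)|) ^ N * |A q.2| * |γ q.1| := by
          gcongr
          exact hbound _ _
      _ = _ := by ring
  let e : ℤ × ℤ ≃ ℤ × ℤ :=
    { toFun := fun q => (q.1 - q.2, q.2)
      invFun := fun q => (q.1 + q.2, q.2)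
      left_inv := fun q => by simp
      right_inv := fun q => by simp }
  have hue : Summable fun q : ℤ × ℤ => b q.1 * (A q.2 * γ (q.1 - q.2)) := by
    refine (e.summable_iff.2 hu).congr fun q => ?_
    simp [e, mul_assoc]
  have heq : ∑' q : ℤ × ℤ, b q.1 * (A q.2 * γ (q.1 - q.2)) =
      ∑' q : ℤ × ℤ, b (q.1 + q.2) * A q.2 * γ q.1 := by
    rw [← e.tsum_eq fun q : ℤ × ℤ => b (q.1 + q.2) * A q.2 * γ q.1]
    refine tsum_congr fun q => ?_
    simp [e, mul_assoc]
  rw [hue.tsum_prod, hu.tsum_prod] at heq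
  simpa only [tsum_mul_left, tsum_mul_right] using heq

lemma abs_tsum_mul_le_polyGrowth {b A : ℤ → ℝ} {C : ℝ} {N : ℕ} (hC : 0 ≤ C)
    (hb : ∀ j, |b j| ≤ C * (1 + |(j : ℝ)|) ^ N)
    (hA : Summable fun n : ℤ => (1 + |(n : ℝ)|) ^ N * |A n|) (m : ℤ) :
    |∑' n, b (m + n) * A n| ≤
      (C * ∑' n : ℤ, (1 + |(n : ℝ)|) ^ N * |A n|) * (1 + |(m : ℝ)|) ^ N := by
  refine tsum_of_norm_bounded (f := fun n => b (m + n) * A n)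
    (g := fun n : ℤ => C * (1 + |(m : ℝ)|) ^ N * ((1 + |(n : ℝ)|) ^ N * |A n|)) ?_ fun n => ?_
  · have := hA.hasSum.mul_left (C * (1 + |(m : ℝ)|) ^ N)
    rwa [mul_right_comm] at this
  · rw [Real.norm_eq_abs, abs_mul, ← mul_assoc]
    gcongr
    refine (hb _).trans ?_
    rw [mul_assoc, ← mul_pow]
    push_cast
    gcongr
    exact one_add_abs_le_mul _ _

end

/-- For a sequence b of polynomial growth, the interpolant
`f_b(x) = Σⱼ bⱼ Lₖ(x - j)` is a k-hyperbolic cardinal spline with `f_b(j) = bⱼ`. -/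
theorem stmt_8 (α : ℝ) (hα : 0 < α) (k : ℕ) (hk : 1 ≤ k) (b : ℤ → ℝ)
    (C β : ℝ) (hC : 0 < C) (hβ : 0 < β)
    (hb : ∀ j : ℤ, |b j| ≤ C * (1 + |(j : ℝ)|) ^ β) :
    IsHyperbolicSpline α k (fun x => ∑' j : ℤ, b j * Lk α k (x - j)) ∧
    ∀ j : ℤ, ∑' i : ℤ, b i * Lk α k ((j : ℝ) - i) = b j := by
  obtain ⟨p, hp, hInt, hF⟩ := exists_fourier_evenExpPoly hα hk
  have hG := fourier_symbol hα hk hInt hF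
  constructor
  · set N := ⌈β⌉₊
    have hbN (j : ℤ) : |b j| ≤ C * (1 + |(j : ℝ)|) ^ N := by
      refine (hb j).trans ?_
      rw [← Real.rpow_natCast]
      gcongr
      · linarith [abs_nonneg (j : ℝ)]
      · exact Nat.le_ceil β
    set A : ℤ → ℝ := fun n => (unitFourierCoeff (symbolSumInv α k) n).re with hAdef
    have hA : Summable fun n : ℤ => (1 + |(n : ℝ)|) ^ N * |A n| := by
      refine Summable.of_nonneg_of_le (fun n => by positivity) (fun n => ?_)
        (summable_pow_mul_norm_unitFourierCoeff (contDiff_symbolSumInv hα hk hG)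
          (periodic_symbolSumInv α k) N)
      gcongr
      exact Complex.abs_re_le_norm _
    have hγ (x : ℝ) : Summable fun m : ℤ => (1 + |(m : ℝ)|) ^ N * |evenExpPoly α p (x - m)| := by
      have h := (summable_mul_evenExpPoly hα p (d := fun m : ℤ => (1 + |(m : ℝ)|) ^ N)
        (K := 1) (N := N) (fun m => by rw [one_mul, abs_of_nonneg (by positivity)]) x).norm
      refine h.congr fun m => ?_
      rw [norm_mul, Real.norm_of_nonneg (by positivity), Real.norm_eq_abs]
    convert isHyperbolicSpline_tsum hα hp (contDiff_evenExpPoly hα hk hG)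
      (abs_tsum_mul_le_polyGrowth hC.le hbN hA) using 2 with x
    rw [← tsum_mul_convolution_eq hC.le hbN hA (hγ x)]
    refine tsum_congr fun j => ?_
    rw [← (hasSum_Lk hα hk hG (x - j)).tsum_eq]
    congr 1
    refine tsum_congr fun n => ?_
    push_cast
    rw [sub_sub_eq_add_sub, sub_add_eq_add_sub]
  · intro j
    have hL (i : ℤ) : Lk α k ((j : ℝ) - i) = if j - i = 0 then 1 else 0 := by
      rw [← Lk_int hα hk hG, Int.cast_sub]
    rw [tsum_eq_single j fun i hi => ?_]
    · rw [hL, sub_self, if_pos rfl, mul_one]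
    · simp [hL, sub_eq_zero, hi.symm]
end
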